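/- arXiv:2310.14410 — 7 statements merged into one kernel-verified Lean document; each statement's English description precedes it below -/
import Mathlib

section
/- Let R be a regular commutative Noetherian ring of prime characteristic p > 0 and let M be an R-module. Then the set of associated primes of the Frobenius base change F_R(M) = F_*R ⊗_R M (where F_*R is R viewed as a module over itself via the Frobenius endomorphism r ↦ r^p, and F_R(M) is regarded as an R-module via the identification of F_*R with R) equals the set of associated primes of M: Ass_R(F_R(M)) = Ass_R(M). -/
/-- `F_* R`: the target of the Frobenius, i.e. `R` itself, but which we will regard as an
`R`-algebra (hence `R`-module) via the Frobenius endomorphism `r ↦ r ^ p`, so that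
`r • F_* s = F_* (r ^ p * s)`.  Tensoring with it realises the Frobenius functor
`F_R (M) = F_* R ⊗_R M`, which is an `R`-module via the identification of `F_* R` with `R`
(acting by plain multiplication on the left tensor factor). -/
def FrobPushforward (R : Type) (p : ℕ) : Type := R

instance (R : Type) [CommRing R] (p : ℕ) : CommRing (FrobPushforward R p) :=
  inferInstanceAs (CommRing R)

noncomputable instance (R : Type) [CommRing R] (p : ℕ) [Fact p.Prime] [CharP R p] :
    Algebra R (FrobPushforward R p) :=
  (frobenius R p).toAlgebra

/-- A commutative Noetherian ring is regular iff the localization at every prime ideal is a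
regular local ring, i.e. its maximal ideal can be generated by `dim`-many elements. -/
def IsRegularCommRing (R : Type) [CommRing R] : Prop :=
  IsNoetherianRing R ∧ ∀ P : PrimeSpectrum R,
    ∃ s : Finset (Localization.AtPrime P.asIdeal),
      Ideal.span (s : Set (Localization.AtPrime P.asIdeal)) =
        IsLocalRing.maximalIdeal (Localization.AtPrime P.asIdeal) ∧
      (s.card : WithBot ℕ∞) = ringKrullDim (Localization.AtPrime P.asIdeal)

universe u v

section TorIndependent

variable (R : Type u) [CommRing R] (S : Type v) [AddCommGroup S] [Module R S]

/-- A module `N` is `Tor`-independent of `S` if tensoring with `S` preserves every short exact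
sequence ending in `N`; this amounts to the vanishing of `Tor₁(S, N)`. -/
def TorIndependent (N : Type u) [AddCommGroup N] [Module R N] : Prop :=
  ∀ ⦃K P : Type u⦄ [AddCommGroup K] [Module R K] [AddCommGroup P] [Module R P]
    (i : K →ₗ[R] P) (g : P →ₗ[R] N), Function.Injective i → Function.Exact i g →
    Function.Surjective g → Function.Injective (i.lTensor S)

variable {R S} {N N' N'' : Type u} [AddCommGroup N] [Module R N] [AddCommGroup N'] [Module R N']
  [AddCommGroup N''] [Module R N'']

namespace TorIndependent

theorem of_linearEquiv (h : TorIndependent R S N) (e : N' ≃ₗ[R] N) : TorIndependent R S N' := by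
  intro K P _ _ _ _ i g hi hig hg
  refine h i (e.toLinearMap ∘ₗ g) hi ?_ (e.surjective.comp hg)
  intro y
  simpa using hig y

theorem of_exact {f : N' →ₗ[R] N} {g : N →ₗ[R] N''} (hf : Function.Injective f)
    (hfg : Function.Exact f g) (hg : Function.Surjective g)
    (h' : TorIndependent R S N') (h'' : TorIndependent R S N'') : TorIndependent R S N := by
  intro K P _ _ _ _ i π hi hiπ hπ
  let L := LinearMap.ker (g ∘ₗ π)
  have hL (y : L) : π y ∈ LinearMap.range f := (hfg _).1 y.2
  let ψ : L →ₗ[R] N' :=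
    (LinearEquiv.ofInjective f hf).symm.toLinearMap ∘ₗ (π ∘ₗ L.subtype).codRestrict _ hL
  have hψ (y : L) : f (ψ y) = π y :=
    congrArg Subtype.val ((LinearEquiv.ofInjective f hf).apply_symm_apply ⟨π y, hL y⟩)
  let j : K →ₗ[R] L := i.codRestrict L fun k ↦ by
    simp [L, hiπ.apply_apply_eq_zero]
  have hj : Function.Injective (j.lTensor S) := by
    refine h' j ψ ?_ ?_ ?_
    · intro a b hab
      exact hi (congrArg Subtype.val hab)
    · intro y
      rw [← hf.eq_iff, hψ, map_zero, hiπ y]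
      constructor
      · rintro ⟨k, hk⟩
        exact ⟨k, Subtype.ext hk⟩
      · rintro ⟨k, rfl⟩
        exact ⟨k, rfl⟩
    · intro n
      obtain ⟨y, hy⟩ := hπ (f n)
      refine ⟨⟨y, by simp [L, hy, hfg.apply_apply_eq_zero]⟩, hf ?_⟩
      rw [hψ, hy]
  have hL' : Function.Injective (L.subtype.lTensor S) :=
    h'' L.subtype (g ∘ₗ π) L.injective_subtype
      (LinearMap.exact_subtype_ker_map _) (hg.comp hπ)
  have : i = L.subtype ∘ₗ j := rfl
  rw [this, LinearMap.lTensor_comp]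
  exact hL'.comp hj

variable (R S) in
theorem self : TorIndependent R S R := by
  intro K P _ _ _ _ i g hi hig hg
  obtain ⟨-, l, hl⟩ := (hig.split_tfae'.out 0 1 rfl rfl).1
    ⟨hi, Module.projective_lifting_property g .id hg⟩
  refine Function.LeftInverse.injective (g := l.lTensor S) fun z ↦ ?_
  rw [← LinearMap.comp_apply, ← LinearMap.lTensor_comp, hl, LinearMap.lTensor_id,
    LinearMap.id_apply]

open scoped Pointwise in
theorem quotSMulTop {x : R} (hN : IsSMulRegular (TensorProduct R S N) x)
    (h : TorIndependent R S N) : TorIndependent R S (QuotSMulTop x N) := by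
  intro K P _ _ _ _ i f hi hif hf
  let π : N →ₗ[R] QuotSMulTop x N := Submodule.mkQ _
  let Q := LinearMap.ker (f ∘ₗ .fst R P N - π ∘ₗ .snd R P N)
  have hQ (a : P × N) : a ∈ Q ↔ f a.1 = π a.2 := by simp [Q, sub_eq_zero]
  let i' : K →ₗ[R] Q := (LinearMap.inl R P N ∘ₗ i).codRestrict Q fun k ↦ by
    simp [hQ, hif.apply_apply_eq_zero]
  let q : Q →ₗ[R] P := .fst R P N ∘ₗ Q.subtype
  let r : Q →ₗ[R] N := .snd R P N ∘ₗ Q.subtype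
  let j : N →ₗ[R] Q := (LinearMap.inr R P N ∘ₗ LinearMap.lsmul R N x).codRestrict Q fun n ↦ by
    rw [hQ]
    exact (map_zero f).trans ((Submodule.Quotient.mk_eq_zero (x • ⊤ : Submodule R N)).2
      (Submodule.smul_mem_pointwise_smul n x ⊤ trivial)).symm
  have hqi : q ∘ₗ i' = i := rfl
  have hri : r ∘ₗ i' = 0 := rfl
  have hrj : r ∘ₗ j = x • .id := rfl
  have hi' : Function.Injective (i'.lTensor S) := by
    refine h i' r (fun a b hab ↦ hi (congrArg q hab)) ?_ ?_
    · rintro ⟨⟨a, n⟩, ha⟩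
      rw [hQ] at ha
      constructor
      · intro (hn : n = 0)
        subst hn
        obtain ⟨k, hk⟩ := (hif a).1 (by simpa using ha)
        exact ⟨k, Subtype.ext (Prod.ext hk rfl)⟩
      · rintro ⟨k, hk⟩
        exact (congrArg r hk).symm
    · intro n
      obtain ⟨a, ha⟩ := hf (π n)
      exact ⟨⟨(a, n), (hQ _).2 ha⟩, rfl⟩
  have hjq : Function.Exact j q := by
    rintro ⟨⟨a, n⟩, ha⟩
    rw [hQ] at ha
    constructor
    · intro (h0 : a = 0)
      subst h0
      have : n ∈ x • (⊤ : Submodule R N) := by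
        rw [← Submodule.Quotient.mk_eq_zero]
        exact ha.symm.trans (map_zero f)
      obtain ⟨m, -, hm⟩ := (Submodule.mem_smul_pointwise_iff_exists _ _ _).1 this
      exact ⟨m, Subtype.ext (Prod.ext rfl hm)⟩
    · rintro ⟨m, hm⟩
      exact (congrArg q hm).symm
  have hq : Function.Surjective q := by
    intro a
    obtain ⟨n, hn⟩ := Submodule.mkQ_surjective _ (f a)
    exact ⟨⟨(a, n), (hQ _).2 hn.symm⟩, rfl⟩
  rw [injective_iff_map_eq_zero]
  intro z hz
  rw [← hqi, LinearMap.lTensor_comp, LinearMap.comp_apply,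
    (lTensor_exact S hjq hq) _] at hz
  obtain ⟨y, hy⟩ := hz
  have hy0 : y = 0 := by
    apply hN.right_eq_zero_of_smul
    have := congrArg (r.lTensor S) hy
    rw [← LinearMap.comp_apply, ← LinearMap.comp_apply, ← LinearMap.lTensor_comp,
      ← LinearMap.lTensor_comp, hri, hrj] at this
    simpa using this
  apply hi'
  rw [← hy, hy0, map_zero, map_zero]

theorem quotient_ofList {rs : List R}
    (hN : RingTheory.Sequence.IsWeaklyRegular (TensorProduct R S N) rs)
    (h : TorIndependent R S N) :
    TorIndependent R S (N ⧸ (Ideal.ofList rs • ⊤ : Submodule R N)) := by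
  induction rs generalizing N with
  | nil =>
    exact h.of_linearEquiv (Submodule.quotEquivOfEqBot _ (by simp))
  | cons x rs ih =>
    rw [RingTheory.Sequence.isWeaklyRegular_cons_iff] at hN
    refine (ih ?_ (h.quotSMulTop hN.1)).of_linearEquiv
      (Submodule.quotOfListConsSMulTopEquivQuotSMulTopInner N x rs)
    exact ((QuotSMulTop.tensorQuotSMulTopEquivQuotSMulTop x S N).isWeaklyRegular_congr rs).2 hN.2

theorem quotient_of_eq_ofList {rs : List R} {I : Ideal R} (hI : Ideal.ofList rs = I)
    (hS : RingTheory.Sequence.IsWeaklyRegular S rs) : TorIndependent R S (R ⧸ I) := by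
  refine (quotient_ofList (rs := rs) (((TensorProduct.rid R S).isWeaklyRegular_congr rs).2 hS)
    (self R S)).of_linearEquiv (Submodule.quotEquivOfEq _ _ (by simp [hI]))

theorem of_pow_le_annihilator [IsNoetherianRing R] [IsLocalRing R] [Module.Finite R N]
    (h : TorIndependent R S (R ⧸ IsLocalRing.maximalIdeal R)) {n : ℕ}
    (hn : IsLocalRing.maximalIdeal R ^ n ≤ Module.annihilator R N) : TorIndependent R S N := by
  induction ‹Module.Finite R N› using IsNoetherianRing.induction_on_isQuotientEquivQuotientPrime R
  with
  | subsingleton N =>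
    intro K P _ _ _ _ i g hi hig hg
    have : Function.Surjective i := fun y ↦ (hig y).1 (Subsingleton.elim _ _)
    exact ((LinearEquiv.ofBijective i ⟨hi, this⟩).lTensor S).injective
  | quotient N p e =>
    refine h.of_linearEquiv (e.trans (Submodule.quotEquivOfEq _ _ ?_))
    rw [e.annihilator_eq, Ideal.annihilator_quotient] at hn
    have := p.2
    exact ((IsLocalRing.maximalIdeal.isMaximal R).eq_of_le this.ne_top
      (this.le_of_pow_le hn)).symm
  | exact N₁ N₂ N₃ f g hf hg hfg h₁ h₃ =>
    exact of_exact hf hfg hg (h₁ (hn.trans (f.annihilator_le_of_injective hf)))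
      (h₃ (hn.trans (g.annihilator_le_of_surjective hg)))

end TorIndependent

end TorIndependent

section Flatness

open IsLocalRing TensorProduct

/-- If `Tor₁` with the residue field vanishes, then a local homomorphism of Noetherian local rings
is flat. -/
theorem Module.Flat.of_torIndependent_residue {R : Type u} {S : Type v} [CommRing R] [CommRing S]
    [Algebra R S] [IsLocalRing R] [IsLocalRing S] [IsNoetherianRing R] [IsNoetherianRing S]
    [IsLocalHom (algebraMap R S)] (h : TorIndependent R S (R ⧸ maximalIdeal R)) :
    Module.Flat R S := by
  rw [Module.Flat.iff_lTensor_injective]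
  intro I _
  rw [injective_iff_map_eq_zero]
  intro z hz
  set m := maximalIdeal R
  have key (n : ℕ) : z ∈ LinearMap.range
      ((Submodule.comap I.subtype (m ^ n)).subtype.lTensor S) := by
    let J := I ⊔ m ^ n
    have hJ : Function.Injective (J.subtype.lTensor S) := by
      refine (h.of_pow_le_annihilator (N := R ⧸ J) (n := n) ?_) J.subtype J.mkQ
        J.injective_subtype (LinearMap.exact_subtype_mkQ J) J.mkQ_surjective
      rw [Ideal.annihilator_quotient]
      exact le_sup_right
    let j : I →ₗ[R] J := Submodule.inclusion le_sup_left
    let L : Submodule R J := Submodule.comap J.subtype (m ^ n)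
    have hz' : j.lTensor S z = 0 := by
      apply hJ
      rw [map_zero, ← hz, ← LinearMap.comp_apply, ← LinearMap.lTensor_comp]
      rfl
    have hex : Function.Exact (Submodule.comap I.subtype (m ^ n)).subtype (L.mkQ ∘ₗ j) := by
      intro y
      simp [L, j]
    have hsurj : Function.Surjective (L.mkQ ∘ₗ j) := by
      intro y
      obtain ⟨⟨y, hy⟩, rfl⟩ := L.mkQ_surjective y
      obtain ⟨a, ha, b, hb, rfl⟩ := Submodule.mem_sup.1 hy
      refine ⟨⟨a, ha⟩, ?_⟩
      rw [LinearMap.comp_apply, ← sub_eq_zero, ← map_sub, ← LinearMap.mem_ker, L.ker_mkQ]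
      simpa [L, j] using hb
    refine (_root_.lTensor_exact S hex hsurj z).1 ?_
    rw [LinearMap.lTensor_comp, LinearMap.comp_apply, hz', map_zero]
  obtain ⟨k, hk⟩ := m.exists_pow_inf_eq_pow_smul (I : Submodule R R)
  have hpow (n : ℕ) : z ∈ (maximalIdeal S ^ n • ⊤ : Submodule S (S ⊗[R] I)) := by
    obtain ⟨w, hw⟩ := key (n + k)
    rw [← hw]
    clear hw
    induction w with
    | zero => simp
    | add a b ha hb => rw [map_add]; exact add_mem ha hb
    | tmul s y =>
      have hy : y.1 ∈ (m ^ n • ⊤ : Submodule R I) := by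
        have hle : m ^ (n + k) • ⊤ ⊓ I ≤ m ^ n • I := by
          have := hk (n + k) (Nat.le_add_left k n)
          rw [Nat.add_sub_cancel] at this
          exact this.trans_le (smul_mono_right _ inf_le_right)
        have hmap : Submodule.map I.subtype (m ^ n • ⊤ : Submodule R I) = m ^ n • I := by
          rw [Submodule.map_smul'', Submodule.map_top, Submodule.range_subtype]
        have hyI : (y.1 : R) ∈ m ^ n • I :=
          hle ⟨by rw [smul_eq_mul, Ideal.mul_top]; exact y.2, y.1.2⟩
        rw [← hmap] at hyI
        obtain ⟨y', hy', h⟩ := hyI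
        rwa [← Subtype.ext h]
      rw [LinearMap.lTensor_tmul, Submodule.subtype_apply]
      refine Submodule.smul_induction_on hy (fun r hr i _ ↦ ?_) fun a b ha hb ↦ ?_
      · rw [TensorProduct.tmul_smul, ← algebraMap_smul S r (s ⊗ₜ[R] i)]
        refine Submodule.smul_mem_smul ?_ Submodule.mem_top
        refine Ideal.pow_right_mono ?_ n (Ideal.map_pow (algebraMap R S) m n ▸
          Ideal.mem_map_of_mem _ hr)
        exact ((local_hom_TFAE (algebraMap R S)).out 0 2).1 ‹_›
      · rw [TensorProduct.tmul_add]
        exact add_mem ha hb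
  have := Ideal.iInf_pow_smul_eq_bot_of_isLocalRing (M := S ⊗[R] I) (maximalIdeal S)
    (maximalIdeal.isMaximal S).ne_top
  rw [← Submodule.mem_bot S, ← this, Submodule.mem_iInf]
  exact hpow

end Flatness

namespace RingTheory.Sequence.IsWeaklyRegular

variable {R : Type*} [CommRing R]

open QuotSMulTop in
theorem of_exact {M₁ M₂ M₃ : Type*} [AddCommGroup M₁] [Module R M₁] [AddCommGroup M₂] [Module R M₂]
    [AddCommGroup M₃] [Module R M₃] {f : M₁ →ₗ[R] M₂} {g : M₂ →ₗ[R] M₃} {rs : List R}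
    (hf : Function.Injective f) (hfg : Function.Exact f g) (hg : Function.Surjective g)
    (h₁ : IsWeaklyRegular M₁ rs) (h₃ : IsWeaklyRegular M₃ rs) : IsWeaklyRegular M₂ rs := by
  induction rs generalizing M₁ M₂ M₃ with
  | nil => exact .nil R M₂
  | cons r rs ih =>
    rw [isWeaklyRegular_cons_iff] at h₁ h₃ ⊢
    refine ⟨isSMulRegular_of_range_eq_ker hf hfg.linearMap_ker_eq.symm h₁.1 h₃.1,
      ih (f := map r f) (g := map r g) ?_ (map_exact r hfg hg) (map_surjective r hg) h₁.2 h₃.2⟩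
    have hzero : Function.Exact (0 : PUnit.{1} →ₗ[R] M₁) f := by
      rw [LinearMap.exact_zero_iff_injective]
      exact hf
    have := map_first_exact_on_four_term_exact_of_isSMulRegular_last hzero hfg h₃.1
    rw [show map r (0 : PUnit.{1} →ₗ[R] M₁) = 0 from _root_.map_zero _] at this
    rwa [LinearMap.exact_zero_iff_injective] at this

theorem of_subsingleton (M : Type*) [AddCommGroup M] [Module R M] [Subsingleton M]
    (rs : List R) : IsWeaklyRegular M rs := by
  induction rs generalizing M with
  | nil => exact .nil R M
  | cons r rs ih =>
    have : Subsingleton (QuotSMulTop r M) := (Submodule.mkQ_surjective _).subsingleton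
    exact .cons (fun _ _ _ ↦ Subsingleton.elim _ _) (ih _)

open scoped Pointwise in
theorem quotSMulTop_pow {M : Type*} [AddCommGroup M] [Module R M] {x : R} {rs : List R}
    (hx : IsSMulRegular M x) (h : IsWeaklyRegular (QuotSMulTop x M) rs) (a : ℕ) :
    IsWeaklyRegular (QuotSMulTop (x ^ a) M) rs := by
  induction a with
  | zero =>
    have : Subsingleton (QuotSMulTop (x ^ 0) M) :=
      Submodule.Quotient.subsingleton_iff.2 (by rw [pow_zero, one_smul])
    exact of_subsingleton _ rs
  | succ a ih =>
    let f : QuotSMulTop (x ^ a) M →ₗ[R] QuotSMulTop (x ^ (a + 1)) M :=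
      Submodule.mapQ _ _ (LinearMap.lsmul R M x) (by
        rintro _ ⟨m, -, rfl⟩
        exact ⟨m, trivial, by
          simp only [DistribSMul.toLinearMap_apply, LinearMap.lsmul_apply, pow_succ', mul_smul]⟩)
    let g : QuotSMulTop (x ^ (a + 1)) M →ₗ[R] QuotSMulTop x M :=
      Submodule.mapQ _ _ LinearMap.id (by
        rintro _ ⟨m, -, rfl⟩
        exact ⟨x ^ a • m, trivial, by simpa [pow_succ', mul_smul] using smul_comm _ _ _⟩)
    refine of_exact (f := f) (g := g) ?_ ?_ ?_ ih h
    · rw [injective_iff_map_eq_zero]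
      intro y hy
      obtain ⟨m, rfl⟩ := Submodule.mkQ_surjective _ y
      obtain ⟨n, -, hn⟩ := (Submodule.Quotient.mk_eq_zero _).1 hy
      refine (Submodule.Quotient.mk_eq_zero _).2 ⟨n, trivial, hx ?_⟩
      simpa [pow_succ', mul_smul] using hn
    · intro y
      obtain ⟨m, rfl⟩ := Submodule.mkQ_surjective _ y
      constructor
      · intro hy
        obtain ⟨n, -, hn⟩ := (Submodule.Quotient.mk_eq_zero _).1 hy
        exact ⟨Submodule.Quotient.mk n, congrArg Submodule.Quotient.mk hn⟩
      · rintro ⟨z, hz⟩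
        obtain ⟨n, rfl⟩ := Submodule.mkQ_surjective _ z
        rw [← hz]
        exact (Submodule.Quotient.mk_eq_zero _).2 ⟨n, trivial, rfl⟩
    · intro y
      obtain ⟨m, rfl⟩ := Submodule.mkQ_surjective _ y
      exact ⟨Submodule.Quotient.mk m, rfl⟩

theorem map_pow {M : Type*} [AddCommGroup M] [Module R M] {rs : List R}
    (h : IsWeaklyRegular M rs) (a : ℕ) : IsWeaklyRegular M (rs.map (· ^ a)) := by
  induction rs generalizing M with
  | nil => exact .nil R M
  | cons r rs ih =>
    rw [isWeaklyRegular_cons_iff] at h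
    rw [List.map_cons, isWeaklyRegular_cons_iff]
    exact ⟨h.1.pow a, ih (quotSMulTop_pow h.1 h.2 a)⟩

end RingTheory.Sequence.IsWeaklyRegular

section RegularLocal

open IsLocalRing RingTheory.Sequence

theorem IsLocalRing.exists_mem_maximalIdeal_notMem_sq {R : Type*} [CommRing R] [IsLocalRing R]
    [IsNoetherianRing R] (h : 0 < ringKrullDim R) :
    ∃ x ∈ maximalIdeal R, x ∉ maximalIdeal R ^ 2 ∧ ∀ P ∈ minimalPrimes R, x ∉ P := by
  classical
  by_contra! hc
  have hP (P : Ideal R) (hP : P ∈ minimalPrimes R) : ¬ maximalIdeal R ≤ P := by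
    intro hle
    have hm : maximalIdeal R ∈ minimalPrimes R := by
      rwa [((maximalIdeal.isMaximal R).eq_of_le hP.1.1.ne_top hle)]
    have := Ideal.height_eq_zero_iff.2 hm
    rw [← IsLocalRing.maximalIdeal_height_eq_ringKrullDim, this] at h
    exact absurd h (by simp)
  let s := (minimalPrimes.finite_of_isNoetherianRing R).toFinset
  have := (Ideal.subset_union_prime (s := insert (maximalIdeal R ^ 2) s) (f := id)
    (maximalIdeal R ^ 2) (maximalIdeal R ^ 2) (I := maximalIdeal R) ?_).1 ?_
  · obtain ⟨J, hJ, hle⟩ := this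
    rcases Finset.mem_insert.1 hJ with rfl | hJ
    · have hbot : maximalIdeal R = ⊥ :=
        Submodule.eq_bot_of_le_smul_of_le_jacobson_bot (maximalIdeal R) (maximalIdeal R)
          (IsNoetherian.noetherian _) (by simpa [sq] using hle) (maximalIdeal_le_jacobson _)
      obtain ⟨P, hPmin, -⟩ := Ideal.exists_minimalPrimes_le (I := (⊥ : Ideal R)) bot_le
        (J := maximalIdeal R)
      exact hP P hPmin (hbot ▸ bot_le)
    · exact hP J (by simpa [s] using hJ) hle
  · intro P hPs hPm _
    have := (Finset.mem_insert.1 hPs).resolve_left hPm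
    exact (show P ∈ minimalPrimes R by simpa [s] using this).1.1
  · intro x hx
    by_cases hx2 : x ∈ maximalIdeal R ^ 2
    · exact Set.mem_biUnion (Finset.mem_insert_self _ _) hx2
    · obtain ⟨P, hPm, hxP⟩ := hc x hx hx2
      exact Set.mem_biUnion (Finset.mem_insert_of_mem (by simpa [s] using hPm)) hxP

theorem Ideal.exists_span_insert_erase_eq {R : Type*} [CommRing R] [IsLocalRing R] [DecidableEq R]
    {s : Finset R} (hs : Ideal.span (s : Set R) = maximalIdeal R) {x : R}
    (hx : x ∈ maximalIdeal R) (hx2 : x ∉ maximalIdeal R ^ 2) :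
    ∃ g ∈ s, Ideal.span (insert x (s.erase g : Set R)) = maximalIdeal R := by
  have hx' := hx
  rw [← hs, Submodule.mem_span_finset] at hx'
  obtain ⟨a, -, ha⟩ := hx'
  have hsm (y : R) (hy : y ∈ s) : y ∈ maximalIdeal R := hs ▸ Ideal.subset_span hy
  obtain ⟨g, hg, hu⟩ : ∃ g ∈ s, IsUnit (a g) := by
    by_contra! hc
    apply hx2
    rw [← ha, sq]
    exact Submodule.sum_mem _ fun y hy ↦ Ideal.mul_mem_mul (hc y hy) (hsm y hy)
  refine ⟨g, hg, le_antisymm (Ideal.span_le.2 ?_) ?_⟩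
  · rintro y (rfl | hy)
    · exact hx
    · exact hsm y (Finset.mem_of_mem_erase hy)
  · rw [← hs, Ideal.span_le]
    intro y hy
    by_cases hyg : y = g
    · subst hyg
      rw [← Finset.add_sum_erase s _ hg] at ha
      have : a y * y = x - ∑ i ∈ s.erase y, a i • i := by
        rw [← ha]; simp
      rw [SetLike.mem_coe, ← Ideal.unit_mul_mem_iff_mem _ hu, this]
      refine sub_mem (Ideal.subset_span (Set.mem_insert _ _)) (Submodule.sum_mem _ fun i hi ↦ ?_)
      exact Ideal.mul_mem_left _ _ (Ideal.subset_span (Set.mem_insert_of_mem _ hi))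
    · exact Ideal.subset_span (Set.mem_insert_of_mem _ (Finset.mem_erase.2 ⟨hyg, hy⟩))

theorem IsLocalRing.isDomain_of_isPrime_span_singleton {R : Type*} [CommRing R] [IsLocalRing R]
    [IsNoetherianRing R] {x : R} (hx : x ∈ maximalIdeal R) [(Ideal.span {x}).IsPrime]
    (hmin : ∀ P ∈ minimalPrimes R, x ∉ P) : IsDomain R := by
  obtain ⟨P, hP, hle⟩ := Ideal.exists_minimalPrimes_le (I := (⊥ : Ideal R))
    (J := Ideal.span {x}) bot_le
  have := hP.1.1
  have hPbot : P = ⊥ := by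
    refine Submodule.eq_bot_of_le_smul_of_le_jacobson_bot (maximalIdeal R) P
      (IsNoetherian.noetherian P) ?_ (maximalIdeal_le_jacobson _)
    intro y hy
    obtain ⟨r, rfl⟩ := Ideal.mem_span_singleton'.1 (hle hy)
    rw [mul_comm]
    exact Submodule.smul_mem_smul hx ((this.mem_or_mem hy).resolve_right (hmin P hP))
  subst hPbot
  exact IsDomain.of_bot_isPrime R

/-- A regular local ring is a domain, and its maximal ideal is generated by a regular sequence. -/
theorem IsLocalRing.isDomain_and_exists_isWeaklyRegular (n : ℕ) {R : Type*} [CommRing R]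
    [IsLocalRing R] [IsNoetherianRing R] (s : Finset R)
    (hs : Ideal.span (s : Set R) = maximalIdeal R) (hcard : s.card ≤ n)
    (hdim : (n : WithBot ℕ∞) ≤ ringKrullDim R) :
    IsDomain R ∧ ∃ rs : List R, IsWeaklyRegular R rs ∧ Ideal.ofList rs = maximalIdeal R := by
  classical
  induction n generalizing R with
  | zero =>
    obtain rfl : s = ∅ := by simpa using hcard
    have hbot : maximalIdeal R = ⊥ := by simpa using hs.symm
    have hR : IsField R := isField_iff_maximalIdeal_eq.2 hbot
    exact ⟨hR.isDomain, [], .nil R R, by simp [hbot]⟩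
  | succ n ih =>
    obtain ⟨x, hx, hx2, hmin⟩ := exists_mem_maximalIdeal_notMem_sq
      (lt_of_lt_of_le (by exact_mod_cast n.succ_pos) hdim)
    obtain ⟨g, hg, hspan⟩ := Ideal.exists_span_insert_erase_eq hs hx hx2
    let A := R ⧸ Ideal.span {x}
    have hle : Ideal.span {x} ≤ maximalIdeal R := by simpa [Ideal.span_le] using hx
    have : Nontrivial A := Ideal.Quotient.nontrivial_iff.2
      (ne_top_of_le_ne_top (maximalIdeal.isMaximal R).ne_top hle)
    let π : R →+* A := Ideal.Quotient.mk _
    have hπ : Function.Surjective π := Ideal.Quotient.mk_surjective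
    have : IsLocalRing A := .of_surjective' π hπ
    have hcomap : ((maximalIdeal R).map π).comap π = maximalIdeal R := by
      rw [Ideal.comap_map_of_surjective' π hπ, Ideal.mk_ker, sup_eq_left.2 hle]
    have hmax : (maximalIdeal R).map π = maximalIdeal A := by
      refine eq_maximalIdeal ((Ideal.map_eq_top_or_isMaximal_of_surjective π hπ
        (maximalIdeal.isMaximal R)).resolve_left fun htop ↦ ?_)
      refine (maximalIdeal.isMaximal R).ne_top ?_
      rw [← hcomap, htop, Ideal.comap_top]
    have hxπ : π x = 0 := Ideal.Quotient.eq_zero_iff_mem.2 (Ideal.mem_span_singleton_self x)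
    obtain ⟨hdom, rs, hrs, hrsm⟩ := ih (R := A) ((s.erase g).image π) (by
        rw [← hmax, ← hspan, Ideal.map_span, Set.image_insert_eq, hxπ, Finset.coe_image]
        simp [Ideal.span_insert])
      (Finset.card_image_le.trans (by rw [Finset.card_erase_of_mem hg]; lia))
      (by
        have := ringKrullDim_le_ringKrullDim_quotient_add_card ({x} : Finset R) (by
          simpa [ringJacobson_eq_maximalIdeal] using hx)
        rw [Finset.coe_singleton, Finset.card_singleton] at this
        have h := hdim.trans this
        push_cast at h
        exact ENat.WithBot.add_le_add_one_right_iff.1 h)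
    have : (Ideal.span {x}).IsPrime := (Ideal.Quotient.isDomain_iff_prime _).1 hdom
    have hR : IsDomain R := isDomain_of_isPrime_span_singleton hx hmin
    have hx0 : x ≠ 0 := fun h ↦ hx2 (h ▸ zero_mem _)
    obtain ⟨ts, rfl⟩ := List.map_surjective_iff.2 hπ rs
    refine ⟨hR, x :: ts, .cons (IsSMulRegular.of_ne_zero hx0) ?_, ?_⟩
    · have e : QuotSMulTop x R ≃ₗ[R] A := Submodule.quotEquivOfEq _ _
        ((Submodule.ideal_span_singleton_smul x ⊤).symm.trans (by simp))
      exact (e.isWeaklyRegular_congr ts).2 ((isWeaklyRegular_map_algebraMap_iff A A ts).1 hrs)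
    · rw [Ideal.ofList_cons, ← hcomap, hmax, ← hrsm, ← Ideal.map_ofList,
        Ideal.comap_map_of_surjective' π hπ, Ideal.mk_ker, sup_comm]

end RegularLocal

section FrobeniusFlat

open IsLocalRing RingTheory.Sequence

theorem FrobPushforward.flat_of_isLocalRing (R : Type) [CommRing R] (p : ℕ) [Fact p.Prime]
    [CharP R p] [IsLocalRing R] [IsNoetherianRing R] (s : Finset R)
    (hs : Ideal.span (s : Set R) = maximalIdeal R)
    (hcard : (s.card : WithBot ℕ∞) = ringKrullDim R) : Module.Flat R (FrobPushforward R p) := by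
  obtain ⟨-, rs, hrs, hm⟩ := isDomain_and_exists_isWeaklyRegular s.card s hs le_rfl hcard.le
  have : IsLocalRing (FrobPushforward R p) := inferInstanceAs (IsLocalRing R)
  have : IsNoetherianRing (FrobPushforward R p) := inferInstanceAs (IsNoetherianRing R)
  have : IsLocalHom (algebraMap R (FrobPushforward R p)) :=
    ⟨fun r (hr : IsUnit (r ^ p)) ↦ (isUnit_pow_iff (Fact.out : p.Prime).ne_zero).1 hr⟩
  refine .of_torIndependent_residue (.quotient_of_eq_ofList hm ?_)
  refine (isWeaklyRegular_map_algebraMap_iff (FrobPushforward R p) (FrobPushforward R p) rs).1 ?_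
  exact hrs.map_pow p

/-- The Frobenius endomorphism of a regular ring is flat (Kunz). -/
theorem FrobPushforward.flat (R : Type) [CommRing R] (p : ℕ) [Fact p.Prime] [CharP R p]
    (hreg : IsRegularCommRing R) : Module.Flat R (FrobPushforward R p) := by
  have := hreg.1
  refine Module.flat_of_localized_maximal _ fun P _ ↦ ?_
  let A := Localization.AtPrime P
  have : CharP A p := (CharP.charP_iff_prime_eq_zero Fact.out).2
    (by rw [← map_natCast (algebraMap R A), CharP.cast_eq_zero, map_zero])
  obtain ⟨s, hs, hcard⟩ := hreg.2 ⟨P, inferInstance⟩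
  have : Module.Flat A (FrobPushforward A p) := flat_of_isLocalRing A p s hs hcard
  let : Algebra R (FrobPushforward A p) :=
    ((algebraMap A (FrobPushforward A p)).comp (algebraMap R A)).toAlgebra
  have : IsScalarTower R A (FrobPushforward A p) := .of_algebraMap_eq fun _ ↦ rfl
  have hflat : Module.Flat R (FrobPushforward A p) := .trans R A _
  let f : FrobPushforward R p →ₗ[R] FrobPushforward A p :=
    { toFun := algebraMap R A
      map_add' := map_add (algebraMap R A)
      map_smul' r := fun (x : R) ↦ by
        change algebraMap R A (r ^ p * x) = algebraMap R A r ^ p * algebraMap R A x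
        rw [map_mul, map_pow] }
  have hsmul (r : R) (x : A) : (r • (show FrobPushforward A p from x) : FrobPushforward A p) =
    (algebraMap R A r ^ p * x : A) := rfl
  have hp : p ≠ 0 := (Fact.out : p.Prime).ne_zero
  have : IsLocalizedModule P.primeCompl f := by
    refine ⟨fun s ↦ ?_, fun y ↦ ?_, fun {x₁ x₂} h ↦ ?_⟩
    · rw [Module.End.isUnit_iff]
      have hu : IsUnit (algebraMap R A s ^ p) := (IsLocalization.map_units A s).pow p
      exact IsUnit.isUnit_iff_mulLeft_bijective.1 hu
    · obtain ⟨r, s, rfl⟩ := IsLocalization.exists_mk'_eq P.primeCompl (show A from y)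
      refine ⟨((r * (s : R) ^ (p - 1) : R), s), (hsmul _ _).trans ?_⟩
      change _ = algebraMap R A (r * s ^ (p - 1))
      obtain ⟨q, rfl⟩ := Nat.exists_eq_succ_of_ne_zero hp
      rw [pow_succ, mul_assoc, IsLocalization.mk'_spec', map_mul, map_pow, mul_comm]
      rfl
    · obtain ⟨c, hc⟩ := (IsLocalization.eq_iff_exists P.primeCompl A).1 h
      have key (x y : R) (h : (c : R) * x = c * y) : (c : R) ^ p * x = (c : R) ^ p * y := by
        rw [← mul_pow_sub_one hp, mul_right_comm, h, mul_right_comm]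
      exact ⟨c, key _ _ hc⟩
  exact .of_linearEquiv (IsLocalizedModule.iso P.primeCompl f)

end FrobeniusFlat

section AssociatedPrimes

open TensorProduct

/-- An element of `S ⊗ M` killed by finitely many scalars comes from the elements of `M` killed by
these scalars, as soon as `S` is flat. -/
theorem Module.Flat.mem_range_lTensor_of_smul_eq_zero {R S M : Type*} [CommRing R] [AddCommGroup S]
    [Module R S] [AddCommGroup M] [Module R M] [Module.Flat R S] (t : Finset R) {z : S ⊗[R] M}
    (hz : ∀ q ∈ t, q • z = 0) : z ∈ LinearMap.range ((LinearMap.ker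
      (LinearMap.pi fun q : t ↦ (q : R) • (LinearMap.id : M →ₗ[R] M))).subtype.lTensor S) := by
  classical
  refine (Module.Flat.lTensor_exact S (LinearMap.exact_subtype_ker_map _) z).1 ?_
  apply (TensorProduct.piRight R R S fun _ : t ↦ M).injective
  ext q
  rw [map_zero, Pi.zero_apply, ← hz q q.2]
  clear hz
  induction z with
  | zero => simp
  | add a b ha hb => rw [map_add, map_add, Pi.add_apply, ha, hb, smul_add]
  | tmul s m => simp

theorem Module.Flat.associatedPrimes_tensorProduct_subset (R S M : Type*) [CommRing R]
    [IsNoetherianRing R] [AddCommGroup S] [Module R S] [AddCommGroup M] [Module R M]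
    [Module.Flat R S] : associatedPrimes R (S ⊗[R] M) ⊆ associatedPrimes R M := by
  intro Q hQ
  rw [AssociatedPrimes.mem_iff, isAssociatedPrime_iff] at hQ ⊢
  obtain ⟨hQ, z, hcolon⟩ := hQ
  have hz (r : R) : r ∈ Q ↔ r • z = 0 := by
    rw [hcolon, Submodule.mem_colon_singleton, Submodule.mem_bot]
  clear hcolon
  refine ⟨hQ, ?_⟩
  by_contra! hc
  obtain ⟨t, ht⟩ := IsNoetherian.noetherian Q
  obtain ⟨w, rfl⟩ := mem_range_lTensor_of_smul_eq_zero t fun q hq ↦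
    (hz q).1 (ht ▸ Ideal.subset_span hq)
  have key : ∃ r ∉ Q, r • w = 0 := by
    clear hz
    induction w with
    | zero => exact ⟨1, Q.ne_top_iff_one.1 hQ.ne_top, smul_zero _⟩
    | add a b ha hb =>
      obtain ⟨r, hr, hra⟩ := ha
      obtain ⟨r', hr', hrb⟩ := hb
      refine ⟨r * r', fun h ↦ (hQ.mem_or_mem h).elim hr hr', ?_⟩
      rw [smul_add, mul_smul r r' b, hrb, mul_comm, mul_smul r' r a, hra]
      simp
    | tmul s l =>
      have hle : Q ≤ Submodule.colon ⊥ {(l : M)} := by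
        rw [← ht, Submodule.span_le]
        intro q hq
        rw [SetLike.mem_coe, Submodule.mem_colon_singleton, Submodule.mem_bot]
        exact congrFun (LinearMap.mem_ker.1 l.2) ⟨q, hq⟩
      obtain ⟨r, hr, hrQ⟩ := SetLike.exists_of_lt (hle.lt_of_ne (hc l))
      refine ⟨r, hrQ, ?_⟩
      rw [Submodule.mem_colon_singleton, Submodule.mem_bot] at hr
      rw [← TensorProduct.tmul_smul, show r • l = 0 from Subtype.ext hr, TensorProduct.tmul_zero]
  obtain ⟨r, hr, hrw⟩ := key
  exact hr ((hz r).2 (by rw [← map_smul, hrw, map_zero]))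

namespace FrobPushforward

variable (R : Type) [CommRing R] (p : ℕ)

/-- The identification of `R` with `F_* R` as rings. -/
def equiv : R ≃+* FrobPushforward R p := RingEquiv.refl R

variable {R p} [Fact p.Prime] [CharP R p] {M : Type} [AddCommGroup M] [Module R M]

theorem equiv_pow_smul (r : R) (z : FrobPushforward R p ⊗[R] M) : equiv R p r ^ p • z = r • z :=
  algebraMap_smul (FrobPushforward R p) r z

theorem equiv_mem_iff_of_eq_colon {Q : Ideal (FrobPushforward R p)} (hQ : Q.IsPrime)
    {z : FrobPushforward R p ⊗[R] M} (hz : Q = Submodule.colon ⊥ {z}) (r : R) :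
    equiv R p r ∈ Q ↔ r • z = 0 := by
  rw [← hQ.pow_mem_iff_mem p (Fact.out : p.Prime).pos, ← equiv_pow_smul, hz,
    Submodule.mem_colon_singleton, Submodule.mem_bot]

theorem nontrivial_tensorProduct_quotient {Q : Ideal (FrobPushforward R p)} (hQ : Q ≠ ⊤) :
    Nontrivial (FrobPushforward R p ⊗[R] (R ⧸ Q.comap (equiv R p))) := by
  have : Nontrivial (FrobPushforward R p ⧸ Q) := Ideal.Quotient.nontrivial_iff.2 hQ
  let g : (R ⧸ Q.comap (equiv R p)) →ₐ[R] FrobPushforward R p ⧸ Q :=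
    Ideal.Quotient.liftₐ _ (Algebra.ofId R _) fun r hr ↦
      Ideal.Quotient.eq_zero_iff_mem.2 (Q.pow_mem_of_mem hr p (Fact.out : p.Prime).pos)
  exact (Algebra.TensorProduct.lift (Ideal.Quotient.mkₐ R Q) g
    fun _ _ ↦ Commute.all _ _).toRingHom.domain_nontrivial

theorem mem_associatedPrimes_tensorProduct_quotient [IsNoetherianRing R]
    [Module.Flat R (FrobPushforward R p)] (Q : Ideal (FrobPushforward R p)) [hQ : Q.IsPrime] :
    Q ∈ associatedPrimes (FrobPushforward R p)
      (FrobPushforward R p ⊗[R] (R ⧸ Q.comap (equiv R p))) := by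
  have : IsNoetherianRing (FrobPushforward R p) := inferInstanceAs (IsNoetherianRing R)
  have := nontrivial_tensorProduct_quotient hQ.ne_top
  obtain ⟨Q', hQ'⟩ := associatedPrimes.nonempty (FrobPushforward R p)
    (FrobPushforward R p ⊗[R] (R ⧸ Q.comap (equiv R p)))
  obtain ⟨hprime, w, hw⟩ := isAssociatedPrime_iff.1 hQ'
  have hw0 : w ≠ 0 := by
    rintro rfl
    exact hprime.ne_top ((Ideal.eq_top_iff_one _).2 (by simp [hw]))
  have hQQ' (r : R) : equiv R p r ∈ Q ↔ equiv R p r ∈ Q' := by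
    rw [equiv_mem_iff_of_eq_colon hprime hw]
    constructor
    · intro hr
      clear hw0 hw
      induction w with
      | zero => simp
      | add a b ha hb => rw [smul_add, ha, hb, add_zero]
      | tmul s y =>
        obtain ⟨y, rfl⟩ := Ideal.Quotient.mk_surjective y
        rw [← TensorProduct.tmul_smul, Algebra.smul_def, Ideal.Quotient.algebraMap_eq,
          Ideal.Quotient.eq_zero_iff_mem.2 (Ideal.mem_comap.2 hr), zero_mul,
          TensorProduct.tmul_zero]
    · intro hr
      by_contra hrQ
      have : (Q.comap (equiv R p)).IsPrime := hQ.comap _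
      have hreg : IsSMulRegular (R ⧸ Q.comap (equiv R p)) r := by
        rw [isSMulRegular_iff_right_eq_zero_of_smul]
        intro a ha
        obtain ⟨a, rfl⟩ := Ideal.Quotient.mk_surjective a
        exact Ideal.Quotient.eq_zero_iff_mem.2
          ((this.mem_or_mem (Ideal.Quotient.eq_zero_iff_mem.1 ha)).resolve_left hrQ)
      exact hw0 ((hreg.lTensor (FrobPushforward R p)).right_eq_zero_of_smul hr)
  have : Q' = Q := .symm <| Ideal.ext fun s ↦ by
    obtain ⟨r, rfl⟩ := (equiv R p).surjective s
    exact hQQ' r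
  exact this ▸ hQ'

theorem mem_associatedPrimes_tensorProduct_iff [IsNoetherianRing R]
    [Module.Flat R (FrobPushforward R p)] {Q : Ideal (FrobPushforward R p)} :
    Q ∈ associatedPrimes (FrobPushforward R p) (FrobPushforward R p ⊗[R] M) ↔
      Q.comap (equiv R p) ∈ associatedPrimes R M := by
  have : IsNoetherianRing (FrobPushforward R p) := inferInstanceAs (IsNoetherianRing R)
  constructor
  · intro hQ
    apply Module.Flat.associatedPrimes_tensorProduct_subset R (FrobPushforward R p) M
    rw [AssociatedPrimes.mem_iff, isAssociatedPrime_iff] at hQ ⊢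
    obtain ⟨hprime, z, hz⟩ := hQ
    refine ⟨hprime.comap _, z, Ideal.ext fun r ↦ ?_⟩
    rw [Ideal.mem_comap, equiv_mem_iff_of_eq_colon hprime hz, Submodule.mem_colon_singleton,
      Submodule.mem_bot]
  · intro hQ
    obtain ⟨hprime, f, hf⟩ := (isAssociatedPrime_iff_exists_injective_linearMap _ _).1 hQ
    have : Q.IsPrime := hprime.comap (equiv R p).symm
    exact (mem_associatedPrimes_tensorProduct_quotient Q).map_of_injective
      (f.baseChange (FrobPushforward R p))
      (Module.Flat.lTensor_preserves_injective_linearMap f hf)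

end FrobPushforward

end AssociatedPrimes

/-- **Huneke–Sharp.** Let `R` be a regular commutative Noetherian ring of
prime characteristic `p > 0` and `M` an `R`-module. Then
`Ass_R (F_R (M)) = Ass_R (M)`, where `F_R (M) = F_* R ⊗_R M` is the Frobenius base change
of `M`, regarded as an `R`-module via the identification of `F_* R` with `R`. -/
theorem stmt4 (R : Type) [CommRing R] (p : ℕ) [Fact p.Prime] [CharP R p]
    (hreg : IsRegularCommRing R) (M : Type) [AddCommGroup M] [Module R M] :
    associatedPrimes (FrobPushforward R p) (TensorProduct R (FrobPushforward R p) M) =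
      associatedPrimes R M := by
  have := hreg.1
  have := FrobPushforward.flat R p hreg
  exact Set.ext fun _ ↦ FrobPushforward.mem_associatedPrimes_tensorProduct_iff
end

section
/- Let A be a commutative ring and let a be a radical ideal of A with minimal (irredundant) primary decomposition a = p_1 ∩ ⋯ ∩ p_t, where the p_i are distinct prime ideals, t ≥ 1, and no p_i contains the intersection of the others. Let b = p_1 ∩ ⋯ ∩ p_m for some 1 ≤ m < t. Then the set of associated primes of the A-module b/a is exactly {p_{m+1}, …, p_t}. -/
/-- The radical of the annihilator of the class of `x` in a submodule of `A ⧸ ⋂ P i`, for prime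
ideals `P i`, consists of the `r` lying in every `P i` that does not contain `x`. -/
theorem mem_radical_colon_mkQ_iInf_iff {A ι : Type*} [CommRing A] (P : ι → Ideal A)
    (hP : ∀ i, (P i).IsPrime) (N : Submodule A (A ⧸ ⨅ i, P i)) (y : N) (x : A)
    (hx : Submodule.mkQ (⨅ i, P i) x = y) (r : A) :
    r ∈ (Submodule.colon (⊥ : Submodule A N) {y}).radical ↔ ∀ i, x ∉ P i → r ∈ P i := by
  have key (s : A) : s ∈ Submodule.colon (⊥ : Submodule A N) {y} ↔ ∀ i, s * x ∈ P i := by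
    rw [Submodule.mem_colon_singleton, Submodule.mem_bot, ← Subtype.coe_inj, Submodule.coe_smul,
      ← hx, ← map_smul, Submodule.coe_zero, Submodule.mkQ_apply, Submodule.Quotient.mk_eq_zero,
      smul_eq_mul, Submodule.mem_iInf]
  constructor
  · rintro ⟨n, hn⟩ i hi
    exact (hP i).mem_of_pow_mem n
      (((hP i).mem_or_mem ((key _).1 hn i)).resolve_right hi)
  · intro h
    refine Ideal.le_radical ((key r).2 fun i => ?_)
    by_cases hi : x ∈ P i
    · exact (P i).mul_mem_left r hi
    · exact (P i).mul_mem_right x (h i hi)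


/-- Let `A` be a commutative ring and `a = p_1 ∩ ⋯ ∩ p_t` a minimal
(irredundant) primary decomposition of a radical ideal into distinct prime ideals (no `p_j`
contains the intersection of the others).  Let `b = p_1 ∩ ⋯ ∩ p_m` for some `1 ≤ m < t`.
Then `Ass_A (b / a) = {p_{m+1}, …, p_t}`, where `b / a` is realised as the image of `b` in
`A ⧸ a`. -/
theorem stmt12 (A : Type) [CommRing A] (t : ℕ) (ht : 1 ≤ t) (P : Fin t → Ideal A)
    (hprime : ∀ i, (P i).IsPrime) (hdist : ∀ i j, i ≠ j → P i ≠ P j)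
    (hirr : ∀ j : Fin t, ¬(⨅ i : Fin t, ⨅ (_ : i ≠ j), P i) ≤ P j)
    (m : ℕ) (hm1 : 1 ≤ m) (hmt : m < t) :
    associatedPrimes A
      ↥(Submodule.map (Submodule.mkQ (⨅ i : Fin t, P i))
        (⨅ i : Fin t, ⨅ (_ : (i : ℕ) < m), P i)) =
      {I | ∃ i : Fin t, m ≤ (i : ℕ) ∧ I = P i} := by
  ext I
  constructor
  · rintro ⟨hI, ⟨y, hy⟩, hrad⟩
    obtain ⟨x, hxb, hxy⟩ := hy
    have hmem (r : A) : r ∈ I ↔ ∀ i, x ∉ P i → r ∈ P i := by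
      rw [hrad]
      exact mem_radical_colon_mkQ_iInf_iff P hprime _ _ x hxy r
    classical
    have hle : (Finset.univ.filter fun i => x ∉ P i).inf P ≤ I := fun r hr =>
      (hmem r).2 fun i hi => Finset.inf_le (f := P) (by simpa using hi) hr
    obtain ⟨i, hi, hiI⟩ := (Ideal.IsPrime.inf_le' hI).1 hle
    have hxi : x ∉ P i := by simpa using hi
    refine ⟨i, ?_, le_antisymm (fun r hr => (hmem r).1 hr i hxi) hiI⟩
    by_contra! him
    simp only [SetLike.mem_coe, Submodule.mem_iInf] at hxb
    exact hxi (hxb i him)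
  · rintro ⟨j, hj, rfl⟩
    obtain ⟨x, hx, hxj⟩ := SetLike.not_le_iff_exists.1 (hirr j)
    simp only [Submodule.mem_iInf] at hx
    have hxb : x ∈ ⨅ i : Fin t, ⨅ (_ : (i : ℕ) < m), P i := by
      simp only [Submodule.mem_iInf]
      rintro i hi
      exact hx i (by rintro rfl; omega)
    refine ⟨hprime j, ⟨_, Submodule.mem_map_of_mem hxb⟩, ?_⟩
    ext r
    rw [mem_radical_colon_mkQ_iInf_iff P hprime _ _ x rfl r]
    refine ⟨fun hr i hi => ?_, fun h => h j hxj⟩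
    obtain rfl : i = j := by
      by_contra hij
      exact hi (hx i hij)
    exact hr
end

section
/- Let n ≥ 3, let P_n be the path on vertices 1,…,n with edges {1,2},…,{n−1,n}, and let a = J(P_n) ⊆ R. For any 1 ≤ i < j ≤ n and 0 ≤ l ≤ j−i−1, set z^{i,j}_l = x_{i+1} ⋯ x_{j−1−l} · y_{j−l} ⋯ y_{j−1} (with z^{i,i+1}_0 = 1). Then z^{i,j}_l · δ_{i,j} ∈ a. -/
open MvPolynomial

/-- `δ_{i,j} = x_i y_j − x_j y_i` in `R = k[x_1,…,x_n,y_1,…,y_n]`, where we realise `R` as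
the polynomial ring over `k` with variables indexed by `Fin n ⊕ Fin n`
(`Sum.inl i ↦ x_i`, `Sum.inr i ↦ y_i`; vertices are numbered `0, …, n-1`). -/
noncomputable def delta (k : Type) [Field k] (n : ℕ) (i j : Fin n) :
    MvPolynomial (Fin n ⊕ Fin n) k :=
  X (Sum.inl i) * X (Sum.inr j) - X (Sum.inl j) * X (Sum.inr i)

/-- The binomial edge ideal `J(G)` of a graph `G`. -/
noncomputable def beIdeal (k : Type) [Field k] (n : ℕ) (G : SimpleGraph (Fin n)) :
    Ideal (MvPolynomial (Fin n ⊕ Fin n) k) :=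
  Ideal.span {f | ∃ i j : Fin n, G.Adj i j ∧ f = delta k n i j}

/-- `a = J(P_n)`: the binomial edge ideal of the path `P_n` on the vertices `0, …, n-1`
with edges `{t, t+1}`. -/
noncomputable def pathIdeal (k : Type) [Field k] (n : ℕ) :
    Ideal (MvPolynomial (Fin n ⊕ Fin n) k) :=
  Ideal.span {f | ∃ (t : Fin n) (h : (t : ℕ) + 1 < n), f = delta k n t ⟨(t : ℕ) + 1, h⟩}

/-- The monomial `z^{i,j}_l = x_{i+1} ⋯ x_{j−1−l} · y_{j−l} ⋯ y_{j−1}` (all variable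
indices lying strictly between `i` and `j`, with `l` of the variables being `y`'s);
`z^{i,i+1}_0 = 1`. -/
noncomputable def ztrunc (k : Type) [Field k] (n : ℕ) (i j : Fin n) (l : ℕ) :
    MvPolynomial (Fin n ⊕ Fin n) k :=
  (∏ t ∈ Finset.univ.filter
      (fun t : Fin n => (i : ℕ) < (t : ℕ) ∧ (t : ℕ) + l + 1 ≤ (j : ℕ)), X (Sum.inl t)) *
  (∏ t ∈ Finset.univ.filter
      (fun t : Fin n => (j : ℕ) ≤ (t : ℕ) + l ∧ (t : ℕ) < (j : ℕ)), X (Sum.inr t))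

/-- If `b t` is one of the variables `x_t`, `y_t` for every `t`, then the product of the `b t`
over the interior vertices of the path from `i` to `j` multiplies `δ_{i,j}` into `J(P_n)`. -/
theorem prod_Ioo_mul_delta_mem_pathIdeal (k : Type) [Field k] (n : ℕ)
    (b : Fin n → Fin n ⊕ Fin n) (hb : ∀ t, b t = Sum.inl t ∨ b t = Sum.inr t)
    (i : Fin n) (m : ℕ) (him : (i : ℕ) < m) (hm : m < n) :
    (∏ t ∈ Finset.Ioo i ⟨m, hm⟩, X (b t)) * delta k n i ⟨m, hm⟩ ∈ pathIdeal k n := by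
  induction m, him using Nat.le_induction with
  | base =>
    exact Ideal.mul_mem_left _ _ (Ideal.subset_span ⟨i, hm, rfl⟩)
  | succ m him ih =>
    have hm' : m < n := by omega
    set j : Fin n := ⟨m, hm'⟩
    set j' : Fin n := ⟨m + 1, hm⟩
    have hins : Finset.Ioo i j' = insert j (Finset.Ioo i j) := by
      ext t
      simp only [Finset.mem_Ioo, Finset.mem_insert, Fin.lt_def, Fin.ext_iff, j, j']
      omega
    have hedge : delta k n j j' ∈ pathIdeal k n := Ideal.subset_span ⟨j, hm, rfl⟩
    rw [hins, Finset.prod_insert (by simp)]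
    set p : MvPolynomial (Fin n ⊕ Fin n) k := ∏ t ∈ Finset.Ioo i j, X (b t)
    rcases hb j with h | h
    · have key : X (b j) * p * delta k n i j' =
          p * X (Sum.inl i) * delta k n j j' + X (Sum.inl j') * (p * delta k n i j) := by
        rw [h, delta, delta, delta]
        ring
      rw [key]
      exact add_mem (Ideal.mul_mem_left _ _ hedge) (Ideal.mul_mem_left _ _ (ih hm'))
    · have key : X (b j) * p * delta k n i j' =
          p * X (Sum.inr i) * delta k n j j' + X (Sum.inr j') * (p * delta k n i j) := by
        rw [h, delta, delta, delta]
        ring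
      rw [key]
      exact add_mem (Ideal.mul_mem_left _ _ hedge) (Ideal.mul_mem_left _ _ (ih hm'))

/-- `z^{i,j}_l` as a single product over the vertices strictly between `i` and `j`. -/
theorem ztrunc_eq_prod_Ioo (k : Type) [Field k] (n : ℕ) (i j : Fin n) (hij : i < j) (l : ℕ)
    (hl : l ≤ (j : ℕ) - (i : ℕ) - 1) :
    ztrunc k n i j l = ∏ t ∈ Finset.Ioo i j,
      X (if (t : ℕ) + l + 1 ≤ (j : ℕ) then Sum.inl t else Sum.inr t) := by
  rw [Fin.lt_def] at hij
  simp only [apply_ite (X (R := k))]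
  rw [Finset.prod_ite, ztrunc]
  congr 2 <;>
  · ext t
    simp only [Finset.mem_filter, Finset.mem_univ, true_and, Finset.mem_Ioo, Fin.lt_def]
    omega

/-- For any `i < j` and `0 ≤ l ≤ j − i − 1`, we have
`z^{i,j}_l · δ_{i,j} ∈ a = J(P_n)`. -/
theorem stmt13 (n : ℕ) (hn : 3 ≤ n) (k : Type) [Field k] (i j : Fin n) (hij : i < j)
    (l : ℕ) (hl : l ≤ (j : ℕ) - (i : ℕ) - 1) :
    ztrunc k n i j l * delta k n i j ∈ pathIdeal k n := by
  rw [ztrunc_eq_prod_Ioo k n i j hij l hl]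
  exact prod_Ioo_mul_delta_mem_pathIdeal k n _ (fun t => by split_ifs <;> simp) i j hij j.isLt
end

section
/- Let n ≥ 3, let P_n be the path on vertices 1,…,n with edges {1,2},…,{n−1,n}, and let a = J(P_n) ⊆ R. For any 2 ≤ i ≤ n−1, the colon ideal satisfies (a : δ_{i−1,i+1}) = (x_i, y_i) + a. -/
open MvPolynomial

section KillVariable

variable {k σ : Type*} [Field k]

open scoped Classical in
/-- The endomorphism of the polynomial ring sending the variable `v` to `0` and fixing the other
variables. -/
noncomputable def killVar (v : σ) : MvPolynomial σ k →ₐ[k] MvPolynomial σ k :=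
  aeval fun w => if w = v then 0 else X w

@[simp] lemma killVar_X_self (v : σ) : killVar (k := k) v (X v) = 0 := by
  simp [killVar]

lemma killVar_X_of_ne {v w : σ} (h : w ≠ v) : killVar (k := k) v (X w) = X w := by
  simp [killVar, h]

lemma degreeOf_killVar (v : σ) (f : MvPolynomial σ k) : degreeOf v (killVar v f) = 0 := by
  induction f using MvPolynomial.induction_on with
  | C a => simp [killVar, algebraMap_eq]
  | add p q hp hq =>
    have := degreeOf_add_le v (killVar v p) (killVar v q)
    rw [map_add]
    omega
  | mul_X p w hp =>
    rw [map_mul]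
    by_cases h : w = v
    · subst h; simp
    · have := degreeOf_mul_le v (killVar v p) (X w)
      rw [degreeOf_X_of_ne (Ne.symm h)] at this
      rw [killVar_X_of_ne h]
      omega

lemma exists_eq_killVar_add (v : σ) (f : MvPolynomial σ k) :
    ∃ g, f = killVar v f + X v * g := by
  induction f using MvPolynomial.induction_on with
  | C a => exact ⟨0, by simp [killVar, algebraMap_eq]⟩
  | add p q hp hq =>
    obtain ⟨a, ha⟩ := hp
    obtain ⟨b, hb⟩ := hq
    exact ⟨a + b, by rw [map_add]; linear_combination ha + hb⟩
  | mul_X p w hp =>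
    obtain ⟨a, ha⟩ := hp
    by_cases h : w = v
    · subst h
      exact ⟨p, by simp [mul_comm]⟩
    · refine ⟨a * X w, ?_⟩
      rw [map_mul, killVar_X_of_ne h]
      linear_combination X w * ha

lemma degreeOf_lt_of_eq_killVar_add {v : σ} {f g : MvPolynomial σ k}
    (h : f = killVar v f + X v * g) (hg : g ≠ 0) : degreeOf v g < degreeOf v f := by
  have h' : g * X v = f - killVar v f := by linear_combination -h
  have h1 : degreeOf v (g * X v) = degreeOf v g + 1 :=
    (degreeOf_mul_X_eq_degreeOf_add_one_iff v g).2 hg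
  have h2 := degreeOf_sub_le v f (killVar v f)
  rw [degreeOf_killVar, ← h', h1] at h2
  omega

/-- An ideal generated by polynomials not involving `v`. -/
def FreeOfVar (v : σ) (I : Ideal (MvPolynomial σ k)) : Prop :=
  ∃ S : Set (MvPolynomial σ k), I = Ideal.span S ∧ ∀ g ∈ S, killVar v g = g

namespace FreeOfVar

variable {v : σ} {I : Ideal (MvPolynomial σ k)}

lemma killVar_mem_and_exists (hI : FreeOfVar v I) {h : MvPolynomial σ k} (hh : h ∈ I) :
    killVar v h ∈ I ∧ ∃ h' ∈ I, h = killVar v h + X v * h' := by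
  obtain ⟨S, rfl, hS⟩ := hI
  induction hh using Submodule.span_induction with
  | mem g hg =>
    rw [hS g hg]
    exact ⟨Ideal.subset_span hg, 0, Ideal.zero_mem _, by simp⟩
  | zero => exact ⟨by simp, 0, Ideal.zero_mem _, by simp⟩
  | add p q _ _ hp hq =>
    obtain ⟨hp, a, ha, hpa⟩ := hp
    obtain ⟨hq, b, hb, hqb⟩ := hq
    rw [map_add]
    exact ⟨Ideal.add_mem _ hp hq, a + b, Ideal.add_mem _ ha hb,
      by linear_combination hpa + hqb⟩
  | smul r p _ hp =>
    obtain ⟨hp, a, ha, hpa⟩ := hp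
    obtain ⟨r', hr⟩ := exists_eq_killVar_add v r
    rw [smul_eq_mul, map_mul]
    exact ⟨Ideal.mul_mem_left _ _ hp, r' * killVar v p + r * a,
      Ideal.add_mem _ (Ideal.mul_mem_left _ _ hp) (Ideal.mul_mem_left _ _ ha),
      by linear_combination killVar v p * hr + r * hpa⟩

lemma killVar_mem (hI : FreeOfVar v I) {h : MvPolynomial σ k} (hh : h ∈ I) : killVar v h ∈ I :=
  (hI.killVar_mem_and_exists hh).1

lemma mem_of_X_mul_mem (hI : FreeOfVar v I) {f : MvPolynomial σ k} (hf : X v * f ∈ I) :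
    f ∈ I := by
  obtain ⟨-, g, hg, h⟩ := hI.killVar_mem_and_exists hf
  rw [map_mul, killVar_X_self, zero_mul, zero_add] at h
  rwa [mul_left_cancel₀ (X_ne_zero v) h]

end FreeOfVar

section Minor

variable {u v : σ} {a b : σ} {I : Ideal (MvPolynomial σ k)}

/-- Let `I` not involve `u, v`. If `b` is a nonzerodivisor modulo `I`, then so is `a v - u b`. -/
lemma mem_of_mul_minor_mem (hu : FreeOfVar u I) (hv : FreeOfVar v I)
    (huv : u ≠ v) (hbv : b ≠ v)
    (hb : ∀ f, f * X b ∈ I → f ∈ I) {f : MvPolynomial σ k}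
    (hf : f * (X a * X v - X u * X b) ∈ I) : f ∈ I := by
  induction hd : degreeOf v f using Nat.strong_induction_on generalizing f with
  | _ d ih =>
    obtain ⟨g, hg⟩ := exists_eq_killVar_add v f
    have h0 : killVar v f ∈ I := by
      have h1 := I.neg_mem (hv.killVar_mem hf)
      rw [map_mul, map_sub, map_mul, map_mul, killVar_X_self, killVar_X_of_ne huv,
        killVar_X_of_ne hbv] at h1
      refine hb _ (hu.mem_of_X_mul_mem ?_)
      convert h1 using 1
      ring
    rw [hg]
    refine I.add_mem h0 (I.mul_mem_left _ ?_)
    by_cases hg0 : g = 0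
    · simp [hg0]
    refine ih _ (hd ▸ degreeOf_lt_of_eq_killVar_add hg hg0) (hv.mem_of_X_mul_mem ?_) rfl
    convert I.sub_mem hf (I.mul_mem_right (X a * X v - X u * X b) h0) using 1
    linear_combination -(X a * X v - X u * X b) * hg

/-- Let `I` not involve `u, v`. If `b` is a nonzerodivisor modulo `I`, then `v` is a nonzerodivisor
modulo `I + (a v - u b)`. -/
lemma exists_of_mul_X_eq_add_mul_minor (hu : FreeOfVar u I) (hv : FreeOfVar v I)
    (huv : u ≠ v) (hbv : b ≠ v)
    (hb : ∀ f, f * X b ∈ I → f ∈ I) {f g h : MvPolynomial σ k} (hh : h ∈ I)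
    (hf : f * X v = g * (X a * X v - X u * X b) + h) :
    ∃ c, f - c * (X a * X v - X u * X b) ∈ I := by
  obtain ⟨c, hc⟩ := exists_eq_killVar_add v g
  have h0 : killVar v g ∈ I := by
    have h1 := congrArg (killVar v) hf
    rw [map_add, map_mul, map_mul, map_sub, map_mul, map_mul, killVar_X_self,
      killVar_X_of_ne huv, killVar_X_of_ne hbv] at h1
    refine hb _ (hu.mem_of_X_mul_mem ?_)
    convert hv.killVar_mem hh using 1
    linear_combination h1
  refine ⟨c, hv.mem_of_X_mul_mem ?_⟩
  convert I.add_mem hh (I.mul_mem_right (X a * X v - X u * X b) h0) using 1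
  linear_combination hf + (X a * X v - X u * X b) * hc

end Minor

end KillVariable

section InfinitePath

variable (k : Type*) [Field k]

/-- The binomial of the edge `{t, t + 1}` of the infinite path on `ℕ`. -/
noncomputable def edgeDelta (t : ℕ) : MvPolynomial (ℕ ⊕ ℕ) k :=
  X (Sum.inl t) * X (Sum.inr (t + 1)) - X (Sum.inl (t + 1)) * X (Sum.inr t)

/-- The binomial edge ideal of the graph on `ℕ` with edges `{t, t + 1}` for `t ∈ T`. -/
noncomputable def edgesIdeal (T : Set ℕ) : Ideal (MvPolynomial (ℕ ⊕ ℕ) k) :=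
  Ideal.span (edgeDelta k '' T)

variable {k}

lemma mem_edgesIdeal_insert {t : ℕ} {T : Set ℕ} {f : MvPolynomial (ℕ ⊕ ℕ) k} :
    f ∈ edgesIdeal k (insert t T) ↔ ∃ c, ∃ h ∈ edgesIdeal k T, f = c * edgeDelta k t + h := by
  rw [edgesIdeal, Set.image_insert_eq, Ideal.mem_span_insert]
  rfl

lemma freeOfVar_edgesIdeal {T : Set ℕ} {m : ℕ} (hT : ∀ t ∈ T, t < m) :
    FreeOfVar (Sum.inl (m + 1)) (edgesIdeal k T) ∧
      FreeOfVar (Sum.inr (m + 1)) (edgesIdeal k T) := by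
  constructor <;>
  · refine ⟨_, rfl, ?_⟩
    rintro _ ⟨t, ht, rfl⟩
    have := hT t ht
    simp only [edgeDelta, map_sub, map_mul]
    rw [killVar_X_of_ne, killVar_X_of_ne, killVar_X_of_ne, killVar_X_of_ne] <;> grind

lemma mem_edgesIdeal_of_mul_X_mem {m : ℕ} {T : Set ℕ} (hT : ∀ t ∈ T, t < m)
    {f : MvPolynomial (ℕ ⊕ ℕ) k} (hf : f * X (Sum.inr m) ∈ edgesIdeal k T) :
    f ∈ edgesIdeal k T := by
  induction m generalizing T f with
  | zero =>
    obtain rfl : T = ∅ := by ext t; simpa using fun h => absurd (hT t h) (by omega)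
    simpa [edgesIdeal] using hf
  | succ m ih =>
    have hT' : ∀ t ∈ T \ {m}, t < m := by grind
    obtain ⟨hu, hv⟩ := freeOfVar_edgesIdeal (k := k) hT'
    by_cases hm : m ∈ T
    · rw [← Set.insert_sdiff_self_of_mem hm, mem_edgesIdeal_insert] at hf ⊢
      obtain ⟨c, h, hh, hf⟩ := hf
      obtain ⟨c', hc'⟩ := exists_of_mul_X_eq_add_mul_minor hu hv (by simp) (by simp)
        (fun _ => ih hT') hh hf
      exact ⟨c', _, hc', by rw [edgeDelta]; ring⟩
    · rw [Set.sdiff_singleton_eq_self hm] at hv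
      exact hv.mem_of_X_mul_mem (by rwa [mul_comm])

lemma mem_edgesIdeal_of_mul_edgeDelta_mem_of_lt {m : ℕ} {T : Set ℕ} (hT : ∀ t ∈ T, t < m)
    {f : MvPolynomial (ℕ ⊕ ℕ) k} (hf : f * edgeDelta k m ∈ edgesIdeal k T) :
    f ∈ edgesIdeal k T := by
  obtain ⟨hu, hv⟩ := freeOfVar_edgesIdeal (k := k) hT
  exact mem_of_mul_minor_mem hu hv (by simp) (by simp)
    (fun _ => mem_edgesIdeal_of_mul_X_mem hT) hf

/-- The binomials of the edges of a path form a regular sequence in any order. -/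
lemma mem_edgesIdeal_of_mul_edgeDelta_mem {m s : ℕ} {T : Set ℕ} (hT : ∀ t ∈ T, t < m)
    (hs : s < m) (hsT : s ∉ T) {f : MvPolynomial (ℕ ⊕ ℕ) k}
    (hf : f * edgeDelta k s ∈ edgesIdeal k T) : f ∈ edgesIdeal k T := by
  induction m generalizing T f with
  | zero => omega
  | succ m ih =>
    have hT' : ∀ t ∈ T \ {m}, t < m := by grind
    by_cases hm : m ∈ T
    · rw [← Set.insert_sdiff_self_of_mem hm, mem_edgesIdeal_insert] at hf ⊢
      have hsm : s < m := by grind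
      obtain ⟨c, h, hh, hf⟩ := hf
      have hc : c ∈ edgesIdeal k (insert s (T \ {m})) := by
        refine mem_edgesIdeal_of_mul_edgeDelta_mem_of_lt (m := m) (by grind) ?_
        exact mem_edgesIdeal_insert.2
          ⟨f, -h, (edgesIdeal k _).neg_mem hh, by linear_combination -hf⟩
      obtain ⟨c', h', hh', rfl⟩ := mem_edgesIdeal_insert.1 hc
      refine ⟨c', f - c' * edgeDelta k m, ih hT' hsm (by grind) ?_, by ring⟩
      convert (edgesIdeal k _).add_mem hh
        ((edgesIdeal k _).mul_mem_right (edgeDelta k m) hh') using 1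
      linear_combination hf
    · by_cases hsm : s = m
      · subst hsm
        exact mem_edgesIdeal_of_mul_edgeDelta_mem_of_lt (by grind) hf
      · exact ih (by grind) (by omega) hsT hf

end InfinitePath

section RemoveVertex

variable (k : Type) [Field k] {n : ℕ} (i : Fin n)

/-- The substitution that kills vertex `i` of the path and closes up the gap. -/
noncomputable def removeVertex :
    MvPolynomial (Fin n ⊕ Fin n) k →ₐ[k] MvPolynomial (ℕ ⊕ ℕ) k :=
  aeval (Sum.elim
    (fun j => if j = i then 0 else X (Sum.inl (if j < i then (j : ℕ) else j - 1)))
    (fun j => if j = i then 0 else X (Sum.inr (if j < i then (j : ℕ) else j - 1))))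

/-- The substitution that reopens the gap at vertex `i`. -/
noncomputable def insertVertex :
    MvPolynomial (ℕ ⊕ ℕ) k →ₐ[k] MvPolynomial (Fin n ⊕ Fin n) k :=
  aeval (Sum.elim
    (fun j => if h : (if j < i then j else j + 1) < n then X (Sum.inl ⟨_, h⟩) else 0)
    (fun j => if h : (if j < i then j else j + 1) < n then X (Sum.inr ⟨_, h⟩) else 0))

lemma insertVertex_removeVertex_sub_mem (f : MvPolynomial (Fin n ⊕ Fin n) k) :
    insertVertex k i (removeVertex k i f) - f ∈
      Ideal.span {X (Sum.inl i), X (Sum.inr i)} := by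
  rw [← Ideal.Quotient.eq]
  have : ((Ideal.Quotient.mkₐ k (Ideal.span {X (Sum.inl i), X (Sum.inr i)})).comp
      ((insertVertex k i).comp (removeVertex k i))) =
      Ideal.Quotient.mkₐ k (Ideal.span {X (Sum.inl i), X (Sum.inr i)}) := by
    refine MvPolynomial.algHom_ext fun j => ?_
    simp only [AlgHom.comp_apply, Ideal.Quotient.mkₐ_eq_mk]
    rcases j with j | j
    all_goals
      rcases lt_trichotomy j i with h | rfl | h
      · simp [removeVertex, insertVertex, h.ne, h]
      · simp only [removeVertex, aeval_X, Sum.elim_inl, Sum.elim_inr, if_true, map_zero]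
        exact (Ideal.Quotient.eq_zero_iff_mem.2 (Ideal.subset_span (by simp))).symm
      · have h' : (i : ℕ) < j := h
        have h1 : ¬ ((j : ℕ) - 1 < i) := by omega
        have h2 : (j : ℕ) - 1 + 1 = j := by omega
        simp [removeVertex, insertVertex, h.ne', h.not_gt, h1, h2]
  exact DFunLike.congr_fun this f

lemma removeVertex_mem_of_mem_pathIdeal {f : MvPolynomial (Fin n ⊕ Fin n) k}
    (hf : f ∈ pathIdeal k n) :
    removeVertex k i f ∈ edgesIdeal k {t | t < n ∧ t + 1 ≠ i} := by
  suffices pathIdeal k n ≤ (edgesIdeal k {t | t < n ∧ t + 1 ≠ i}).comap (removeVertex k i) from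
    this hf
  refine Ideal.span_le.2 ?_
  rintro _ ⟨t, h, rfl⟩
  simp only [SetLike.mem_coe, Ideal.mem_comap, delta, map_sub, map_mul, removeVertex, aeval_X,
    Sum.elim_inl, Sum.elim_inr]
  by_cases hti : t = i
  · simp [hti]
  by_cases hti' : (⟨t + 1, h⟩ : Fin n) = i
  · simp [hti']
  have h3 : (t : ℕ) + 1 ≠ i := fun h => hti' (Fin.ext h)
  have h3' : (t : ℕ) ≠ i := fun h => hti (Fin.ext h)
  simp only [hti, hti', if_false, Fin.lt_def]
  rcases lt_or_gt_of_ne h3' with h4 | h4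
  · rw [if_pos h4, if_pos (by omega)]
    exact Ideal.subset_span ⟨t, ⟨t.2, h3⟩, rfl⟩
  · rw [if_neg (by omega), if_neg (by omega)]
    refine Ideal.subset_span ⟨t - 1, ⟨by omega, by omega⟩, ?_⟩
    rw [edgeDelta, show (t : ℕ) - 1 + 1 = t by omega, show (t : ℕ) + 1 - 1 = t by omega]

lemma insertVertex_mem_pathIdeal {f : MvPolynomial (ℕ ⊕ ℕ) k}
    (hf : f ∈ edgesIdeal k {t | t < n ∧ t + 1 ≠ i}) : insertVertex k i f ∈ pathIdeal k n := by
  suffices edgesIdeal k {t | t < n ∧ t + 1 ≠ i} ≤ (pathIdeal k n).comap (insertVertex k i) from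
    this hf
  refine Ideal.span_le.2 ?_
  rintro _ ⟨t, ⟨-, hti⟩, rfl⟩
  simp only [SetLike.mem_coe, Ideal.mem_comap, edgeDelta, map_sub, map_mul, insertVertex, aeval_X,
    Sum.elim_inl, Sum.elim_inr]
  have key : (if t + 1 < (i : ℕ) then t + 1 else t + 1 + 1) =
      (if t < (i : ℕ) then t else t + 1) + 1 := by
    split_ifs <;> omega
  simp only [key]
  by_cases h : (if t < (i : ℕ) then t else t + 1) + 1 < n
  · have h' := Nat.lt_of_succ_lt h
    rw [dif_pos h, dif_pos h, dif_pos h', dif_pos h']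
    exact Ideal.subset_span ⟨⟨_, h'⟩, h, rfl⟩
  · rw [dif_neg h, dif_neg h]
    simp

end RemoveVertex

lemma delta_mem_pathIdeal (k : Type) [Field k] {n : ℕ} {a b : Fin n} (h : (a : ℕ) + 1 = b) :
    delta k n a b ∈ pathIdeal k n :=
  Ideal.subset_span ⟨a, h ▸ b.2, by congr; exact Fin.ext h.symm⟩

/-- For any interior vertex `i` of the path `P_n` (i.e. `2 ≤ i ≤ n−1`
with vertices numbered `1, …, n`), we have `(a : δ_{i−1,i+1}) = (x_i, y_i) + a`. -/
theorem stmt14 (n : ℕ) (hn : 3 ≤ n) (k : Type) [Field k] (i : Fin n)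
    (h1 : 1 ≤ (i : ℕ)) (h2 : (i : ℕ) + 1 < n) :
    Submodule.colon (pathIdeal k n)
        (Ideal.span {delta k n ⟨(i : ℕ) - 1, Nat.lt_of_le_of_lt (by omega) h2⟩
          ⟨(i : ℕ) + 1, h2⟩}) =
      Ideal.span {X (Sum.inl i), X (Sum.inr i)} ⊔ pathIdeal k n := by
  have hm1 : (i : ℕ) - 1 < n := by omega
  have hlow : delta k n ⟨(i : ℕ) - 1, hm1⟩ i ∈ pathIdeal k n :=
    delta_mem_pathIdeal k (Nat.sub_add_cancel h1)
  have hhigh : delta k n i ⟨(i : ℕ) + 1, h2⟩ ∈ pathIdeal k n := delta_mem_pathIdeal k rfl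
  ext f
  have hcolon : f ∈ Submodule.colon (pathIdeal k n)
      (Ideal.span {delta k n ⟨(i : ℕ) - 1, hm1⟩ ⟨(i : ℕ) + 1, h2⟩}) ↔
      f * delta k n ⟨(i : ℕ) - 1, hm1⟩ ⟨(i : ℕ) + 1, h2⟩ ∈ pathIdeal k n :=
    Ideal.mem_colon_span_singleton
  rw [hcolon]
  constructor
  · intro hf
    have hF := removeVertex_mem_of_mem_pathIdeal k i hf
    have hd : removeVertex k i (delta k n ⟨(i : ℕ) - 1, hm1⟩ ⟨(i : ℕ) + 1, h2⟩) =
        edgeDelta k (i - 1) := by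
      have e1 : (i : ℕ) - 1 < i := by omega
      have e2 : ¬ ((i : ℕ) + 1 < i) := by omega
      have e3 : (i : ℕ) - 1 ≠ i := by omega
      simp [delta, removeVertex, edgeDelta, Fin.ext_iff, Fin.lt_def, -Fin.val_fin_lt, e1, e2, e3,
        Nat.sub_add_cancel h1]
    rw [map_mul, hd] at hF
    have hE := mem_edgesIdeal_of_mul_edgeDelta_mem (m := n) (fun t ht => ht.1) hm1
      (fun h => h.2 (Nat.sub_add_cancel h1)) hF
    have hB := Ideal.mem_sup_right (S := Ideal.span {X (Sum.inl i), X (Sum.inr i)})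
      (insertVertex_mem_pathIdeal k i hE)
    have hS := Ideal.mem_sup_left (T := pathIdeal k n) (insertVertex_removeVertex_sub_mem k i f)
    simpa using Ideal.sub_mem _ hB hS
  · intro hf
    obtain ⟨p, hp, q, hq, rfl⟩ := Submodule.mem_sup.1 hf
    obtain ⟨a, b, rfl⟩ := Ideal.mem_span_pair.1 hp
    have hcomb := Ideal.add_mem _
      (Ideal.add_mem _
        (Ideal.mul_mem_left _ (a * X (Sum.inl ⟨(i : ℕ) - 1, hm1⟩) +
          b * X (Sum.inr ⟨(i : ℕ) - 1, hm1⟩)) hhigh)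
        (Ideal.mul_mem_left _ (a * X (Sum.inl ⟨(i : ℕ) + 1, h2⟩) +
          b * X (Sum.inr ⟨(i : ℕ) + 1, h2⟩)) hlow))
      (Ideal.mul_mem_right (delta k n ⟨(i : ℕ) - 1, hm1⟩ ⟨(i : ℕ) + 1, h2⟩) _ hq)
    convert hcomb using 1
    simp only [delta]
    ring
end

section
/- Let n ≥ 3, let a = J(P_n), for 0 ≤ l ≤ n−2 set z_l = x_2 ⋯ x_{n−1−l} · y_{n−l} ⋯ y_{n−1}, and let b = a + (z_0, …, z_{n−2}). Give R the ℕ^n-grading with deg(x_i) = deg(y_i) = e_i (the i-th standard basis vector). Then every homogeneous element of R of degree (0,1,1,…,1,0) belongs to b. -/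
open MvPolynomial

/-- The monomial `z_l = x_2 ⋯ x_{n−1−l} · y_{n−l} ⋯ y_{n−1}` (with vertices numbered
`1, …, n`; here the vertices are `0, …, n-1`, so the `x`-indices run over
`1, …, n-2-l` and the `y`-indices over `n-1-l, …, n-2`). -/
noncomputable def zfull (k : Type) [Field k] (n : ℕ) (l : ℕ) :
    MvPolynomial (Fin n ⊕ Fin n) k :=
  (∏ t ∈ Finset.univ.filter
      (fun t : Fin n => 0 < (t : ℕ) ∧ (t : ℕ) + l + 2 ≤ n), X (Sum.inl t)) *
  (∏ t ∈ Finset.univ.filter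
      (fun t : Fin n => n ≤ (t : ℕ) + l + 1 ∧ (t : ℕ) + 2 ≤ n), X (Sum.inr t))

/-- If `x i * y (i + 1) = x (i + 1) * y i`, a factor `x` moves to the front of a product of
consecutive `y`s. -/
theorem prod_Ico_mul_shift {A : Type*} [CommRing A] {x y : ℕ → A}
    (h : ∀ i, x i * y (i + 1) = x (i + 1) * y i) {a b : ℕ} (hab : a ≤ b) :
    (∏ i ∈ Finset.Ico a b, y i) * x b = x a * ∏ i ∈ Finset.Ico (a + 1) (b + 1), y i := by
  induction b, hab using Nat.le_induction with
  | base => simp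
  | succ b hab ih =>
    rw [Finset.prod_Ico_succ_top hab, Finset.prod_Ico_succ_top (by omega : a + 1 ≤ b + 1),
      ← mul_assoc, ← ih, mul_assoc, mul_assoc, h b, mul_comm (y b)]

/-- If `x i * y (i + 1) = x (i + 1) * y i`, a product of consecutive factors, each `x i` or `y i`,
can be sorted so that the `x`s precede the `y`s. -/
theorem exists_prod_Ico_eq_sorted {A : Type*} [CommRing A] {x y f : ℕ → A}
    (h : ∀ i, x i * y (i + 1) = x (i + 1) * y i) {a b : ℕ} (hab : a ≤ b)
    (hf : ∀ i, a ≤ i → i < b → f i = x i ∨ f i = y i) :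
    ∃ c, a ≤ c ∧ c ≤ b ∧
      ∏ i ∈ Finset.Ico a b, f i = (∏ i ∈ Finset.Ico a c, x i) * ∏ i ∈ Finset.Ico c b, y i := by
  induction b, hab using Nat.le_induction with
  | base => exact ⟨a, le_rfl, le_rfl, by simp⟩
  | succ b hab ih =>
    obtain ⟨c, hac, hcb, hc⟩ := ih fun i hi hib => hf i hi (by omega)
    rw [Finset.prod_Ico_succ_top hab, hc]
    rcases hf b hab (by omega) with hx | hy
    · refine ⟨c + 1, by omega, by omega, ?_⟩
      rw [hx, mul_assoc, prod_Ico_mul_shift h hcb, Finset.prod_Ico_succ_top hac, mul_assoc]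
    · refine ⟨c, hac, by omega, ?_⟩
      rw [hy, Finset.prod_Ico_succ_top hcb, mul_assoc]

/-- A product over the indices in `Fin n` with values in `[a, b)` as a product over `[a, b)`. -/
theorem Fin.prod_filter_eq_prod_Ico {A : Type*} [CommMonoid A] {n a b : ℕ} (hb : b ≤ n)
    (p : Fin n → Prop) [DecidablePred p] (hp : ∀ t : Fin n, p t ↔ a ≤ (t : ℕ) ∧ (t : ℕ) < b)
    (f : Fin n → A) (g : ℕ → A) (hfg : ∀ t : Fin n, g t = f t) :
    ∏ t ∈ Finset.univ.filter p, f t = ∏ i ∈ Finset.Ico a b, g i := by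
  refine Finset.prod_bij (fun t _ => (t : ℕ)) ?_ ?_ ?_ ?_
  · intro t ht
    simpa [hp] using ht
  · intro s _ t _ hst
    exact Fin.ext hst
  · intro i hi
    rw [Finset.mem_Ico] at hi
    exact ⟨⟨i, by omega⟩, by simpa [hp] using hi, rfl⟩
  · intro t _
    exact (hfg t).symm

/-- Modulo `J(P_n)`, a monomial of degree `(0,1,…,1,0)` is one of the `z_l`. -/
theorem exists_monomial_sub_zfull_mem_pathIdeal (k : Type) [Field k] {n : ℕ} (hn : 3 ≤ n)
    (m : Fin n ⊕ Fin n →₀ ℕ)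
    (hm : ∀ t : Fin n,
      m (Sum.inl t) + m (Sum.inr t) = if (t : ℕ) = 0 ∨ (t : ℕ) + 1 = n then 0 else 1) :
    ∃ l ≤ n - 2, monomial m (1 : k) - zfull k n l ∈ pathIdeal k n := by
  let q := Ideal.Quotient.mk (pathIdeal k n)
  let x : ℕ → _ := fun i => if h : i < n then q (X (Sum.inl ⟨i, h⟩)) else 0
  let y : ℕ → _ := fun i => if h : i < n then q (X (Sum.inr ⟨i, h⟩)) else 0
  let f : ℕ → _ := fun i => if h : i < n then
    q (X (Sum.inl ⟨i, h⟩) ^ m (Sum.inl ⟨i, h⟩) * X (Sum.inr ⟨i, h⟩) ^ m (Sum.inr ⟨i, h⟩)) else 0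
  have hxy : ∀ i, x i * y (i + 1) = x (i + 1) * y i := by
    intro i
    by_cases h : i + 1 < n
    · have h' : i < n := by omega
      simp only [x, y, h, h', dif_pos]
      rw [← map_mul, ← map_mul]
      exact Ideal.Quotient.eq.2 (Ideal.subset_span ⟨⟨i, h'⟩, h, rfl⟩)
    · simp [x, y, h]
  have hf : ∀ i, 1 ≤ i → i < n - 1 → f i = x i ∨ f i = y i := by
    intro i hi hin
    have h : i < n := by omega
    have hd := hm ⟨i, h⟩
    rw [if_neg (by simp only; omega)] at hd
    simp only [f, x, y, h, dif_pos]
    rcases (by omega : m (Sum.inl ⟨i, h⟩) = 1 ∧ m (Sum.inr ⟨i, h⟩) = 0 ∨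
      m (Sum.inl ⟨i, h⟩) = 0 ∧ m (Sum.inr ⟨i, h⟩) = 1) with ⟨h₁, h₂⟩ | ⟨h₁, h₂⟩ <;>
    simp [h₁, h₂]
  obtain ⟨c, hc₁, hcn, hc⟩ := exists_prod_Ico_eq_sorted hxy (by omega : 1 ≤ n - 1) hf
  refine ⟨n - 1 - c, by omega, Ideal.Quotient.eq.1 ?_⟩
  have hmon : q (monomial m 1) = ∏ i ∈ Finset.Ico 1 (n - 1), f i := by
    rw [← Fin.prod_filter_eq_prod_Ico (by omega)
      (fun t : Fin n => 1 ≤ (t : ℕ) ∧ (t : ℕ) < n - 1) (fun _ => Iff.rfl)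
      (fun t => q (X (Sum.inl t) ^ m (Sum.inl t) * X (Sum.inr t) ^ m (Sum.inr t))) f
      (fun t => by simp [f]), monomial_eq, Finsupp.prod_fintype _ _ (fun _ => pow_zero _),
      Fintype.prod_sum_type, ← Finset.prod_mul_distrib, C_1, one_mul, map_prod]
    refine (Finset.prod_subset (Finset.filter_subset _ _) ?_).symm
    intro t _ ht
    have hd := hm t
    have := t.2
    simp only [Finset.mem_filter, Finset.mem_univ, true_and] at ht
    rw [if_pos (by omega)] at hd
    obtain ⟨h₁, h₂⟩ := Nat.add_eq_zero_iff.1 hd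
    simp [h₁, h₂]
  change q _ = q _
  rw [hmon, hc, zfull, map_mul, map_prod, map_prod]
  congr 1
  · exact (Fin.prod_filter_eq_prod_Ico (by omega) _ (fun t => by omega) _ x
      (fun t => by simp [x])).symm
  · exact (Fin.prod_filter_eq_prod_Ico (by omega) _ (fun t => by omega) _ y
      (fun t => by simp [y])).symm

/-- With `b = a + (z_0, …, z_{n−2})` and the `ℕ^n`-grading on `R` with
`deg x_i = deg y_i = e_i`, every homogeneous element of `R` of degree `(0,1,1,…,1,0)`
belongs to `b`.  (A polynomial is homogeneous of degree `(0,1,…,1,0)` iff every monomial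
in its support has, for each vertex `t`, total exponent in `x_t, y_t` equal to `1` for
interior vertices `t` and `0` for the two endpoint vertices.) -/
theorem stmt15 (n : ℕ) (hn : 3 ≤ n) (k : Type) [Field k]
    (c : MvPolynomial (Fin n ⊕ Fin n) k)
    (hc : ∀ m ∈ c.support, ∀ t : Fin n,
      m (Sum.inl t) + m (Sum.inr t) = if (t : ℕ) = 0 ∨ (t : ℕ) + 1 = n then 0 else 1) :
    c ∈ pathIdeal k n ⊔ Ideal.span {f | ∃ l ≤ n - 2, f = zfull k n l} := by
  rw [c.as_sum]
  refine Ideal.sum_mem _ fun m hm => ?_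
  obtain ⟨l, hl, hz⟩ := exists_monomial_sub_zfull_mem_pathIdeal k hn m (hc m hm)
  rw [← mul_one (coeff m c), ← C_mul_monomial, ← sub_add_cancel (monomial m 1) (zfull k n l)]
  exact Ideal.mul_mem_left _ _
    (Submodule.add_mem_sup hz (Ideal.subset_span ⟨l, hl, rfl⟩))
end

section
/- Let k be a field of prime characteristic p > 0 and n ≥ 3. Let G be a Hamiltonian graph on n vertices containing the cycle C_n with edges {1,2},…,{n−1,n},{1,n}, let g = J(G) and a = J(P_n), and for 0 ≤ l ≤ n−2 set z_l = x_2 ⋯ x_{n−1−l} · y_{n−l} ⋯ y_{n−1}. Then the colon ideal satisfies (a : g) = a + (z_0, z_1, …, z_{n−2}). -/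
open MvPolynomial

/-- The exponent sum of `x_j`, `j < t`. -/
def prefixSum {n : ℕ} (u : Fin n ⊕ Fin n →₀ ℕ) (t : ℕ) : ℕ :=
  ∑ j ∈ Finset.univ.filter fun j : Fin n => (j : ℕ) < t, u (Sum.inl j)

/-- The multidegree of a monomial for the grading `deg x_j = deg y_j = e_j`. -/
def vertexDeg {n : ℕ} (u : Fin n ⊕ Fin n →₀ ℕ) (j : Fin n) : ℕ :=
  u (Sum.inl j) + u (Sum.inr j)

section Exponents

variable {n : ℕ}

lemma vertexDeg_add (u v : Fin n ⊕ Fin n →₀ ℕ) (j : Fin n) :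
    vertexDeg (u + v) j = vertexDeg u j + vertexDeg v j := by
  simp only [vertexDeg, Finsupp.add_apply]; omega

lemma prefixSum_add (u v : Fin n ⊕ Fin n →₀ ℕ) (t : ℕ) :
    prefixSum (u + v) t = prefixSum u t + prefixSum v t := by
  simp [prefixSum, Finset.sum_add_distrib]

lemma prefixSum_zero (u : Fin n ⊕ Fin n →₀ ℕ) : prefixSum u 0 = 0 := by
  simp [prefixSum]

lemma prefixSum_succ (u : Fin n ⊕ Fin n →₀ ℕ) (j : Fin n) :
    prefixSum u (j + 1) = prefixSum u j + u (Sum.inl j) := by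
  unfold prefixSum
  have : (Finset.univ.filter fun i : Fin n => (i : ℕ) < j + 1) =
      insert j (Finset.univ.filter fun i : Fin n => (i : ℕ) < j) := by
    ext i
    simp only [Finset.mem_filter, Finset.mem_univ, true_and, Finset.mem_insert, Fin.ext_iff]
    omega
  rw [this, Finset.sum_insert (by simp), add_comm]

lemma prefixSum_card (u : Fin n ⊕ Fin n →₀ ℕ) :
    prefixSum u n = ∑ j, u (Sum.inl j) := by
  simp [prefixSum]

lemma prefixSum_single_inl (j : Fin n) (t : ℕ) :
    prefixSum (Finsupp.single (Sum.inl j) 1) t = if (j : ℕ) < t then 1 else 0 := by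
  simp [prefixSum, Finsupp.single_apply, Finset.sum_ite_eq]

lemma prefixSum_single_inr (j : Fin n) (t : ℕ) :
    prefixSum (Finsupp.single (Sum.inr j) 1) t = 0 := by
  simp [prefixSum]

lemma vertexDeg_single_inl (j i : Fin n) :
    vertexDeg (Finsupp.single (Sum.inl j) 1) i = if j = i then 1 else 0 := by
  simp [vertexDeg, Finsupp.single_apply]

lemma vertexDeg_single_inr (j i : Fin n) :
    vertexDeg (Finsupp.single (Sum.inr j) 1) i = if j = i then 1 else 0 := by
  simp [vertexDeg, Finsupp.single_apply]

lemma ext_of_vertexDeg_prefixSum {u v : Fin n ⊕ Fin n →₀ ℕ}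
    (hd : ∀ j, vertexDeg u j = vertexDeg v j) (hS : ∀ t ≤ n, prefixSum u t = prefixSum v t) :
    u = v := by
  have hx (j : Fin n) : u (Sum.inl j) = v (Sum.inl j) := by
    have h1 := hS j (by omega)
    have h2 := hS (j + 1) (by omega)
    rw [prefixSum_succ, prefixSum_succ] at h2
    omega
  ext (j | j)
  · exact hx j
  · have := hd j
    have := hx j
    simp only [vertexDeg] at *
    omega

lemma single_add_single_le {σ : Type*} {u : σ →₀ ℕ} {a b : σ} (hab : a ≠ b) (ha : 0 < u a)
    (hb : 0 < u b) : Finsupp.single a 1 + Finsupp.single b 1 ≤ u := by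
  classical
  intro i
  simp only [Finsupp.add_apply, Finsupp.single_apply]
  split_ifs with h1 h2 h2
  · exact absurd (h1.trans h2.symm) hab
  · subst h1; omega
  · subst h2; omega
  · omega

/-- If `u` is strictly ahead of `v` at `s` and `y_s` divides `u`, then some factor
`x_r y_{r+1}` of `u` can be exchanged to bring `u` closer to `v`. -/
lemma exists_exchange_of_pos {u v : Fin n ⊕ Fin n →₀ ℕ}
    (hz : ∀ j : Fin n, vertexDeg u j = 0 → prefixSum u j = prefixSum v j) :
    ∀ (s : ℕ) (hs : s < n), prefixSum v s < prefixSum u s → 0 < u (Sum.inr ⟨s, hs⟩) →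
      ∃ (r : Fin n) (h : (r : ℕ) + 1 < n), 0 < u (Sum.inl r) ∧ 0 < u (Sum.inr ⟨r + 1, h⟩) ∧
        prefixSum v (r + 1) < prefixSum u (r + 1) := by
  intro s
  induction s with
  | zero => intro hs h; simp [prefixSum_zero] at h
  | succ s ih =>
    intro hs h hy
    by_cases hx : 0 < u (Sum.inl ⟨s, by omega⟩)
    · exact ⟨⟨s, by omega⟩, hs, hx, hy, h⟩
    · have h1 := prefixSum_succ u ⟨s, by omega⟩
      have h2 := prefixSum_succ v ⟨s, by omega⟩
      simp only at h1 h2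
      have h3 : prefixSum v s < prefixSum u s := by omega
      have h4 : vertexDeg u ⟨s, by omega⟩ ≠ 0 := fun h0 => by
        have := hz _ h0
        simp only at this
        omega
      refine ih (by omega) h3 ?_
      simp only [vertexDeg] at h4
      omega

lemma exists_exchange {u v : Fin n ⊕ Fin n →₀ ℕ}
    (hd : ∀ j, vertexDeg u j = vertexDeg v j)
    (hz : ∀ j : Fin n, vertexDeg u j = 0 → prefixSum u j = prefixSum v j)
    (hn : prefixSum u n = prefixSum v n) (t : ℕ) (ht : t ≤ n)
    (hlt : prefixSum v t < prefixSum u t) :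
    ∃ (r : Fin n) (h : (r : ℕ) + 1 < n), 0 < u (Sum.inl r) ∧ 0 < u (Sum.inr ⟨r + 1, h⟩) ∧
      prefixSum v (r + 1) < prefixSum u (r + 1) := by
  induction ht using Nat.decreasingInduction with
  | self => omega
  | of_succ t ht ih =>
    by_cases h : prefixSum v (t + 1) < prefixSum u (t + 1)
    · exact ih h
    · have h1 := prefixSum_succ u ⟨t, by omega⟩
      have h2 := prefixSum_succ v ⟨t, by omega⟩
      have h3 := hd ⟨t, by omega⟩
      simp only [vertexDeg] at h1 h2 h3
      exact exists_exchange_of_pos hz t ht hlt (by omega)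

end Exponents

section Congruence

variable (k : Type) [Field k] {n : ℕ}

lemma monomial_mul_delta (w : Fin n ⊕ Fin n →₀ ℕ) (i j : Fin n) :
    monomial w 1 * delta k n i j =
      monomial (w + (Finsupp.single (Sum.inl i) 1 + Finsupp.single (Sum.inr j) 1)) 1 -
      monomial (w + (Finsupp.single (Sum.inl j) 1 + Finsupp.single (Sum.inr i) 1)) 1 := by
  simp [delta, X, mul_sub, monomial_mul]

/-- Monomials with the same multidegree and the same `x`-degree on every connected component of
their support are congruent modulo the path ideal. -/
lemma monomial_sub_mem_pathIdeal {u v : Fin n ⊕ Fin n →₀ ℕ}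
    (hd : ∀ j, vertexDeg u j = vertexDeg v j)
    (hz : ∀ j : Fin n, vertexDeg u j = 0 → prefixSum u j = prefixSum v j)
    (hn : prefixSum u n = prefixSum v n) :
    monomial u (1 : k) - monomial v 1 ∈ pathIdeal k n := by
  obtain ⟨N, hN⟩ : ∃ N, ∑ t ∈ Finset.range (n + 1),
      ((prefixSum u t - prefixSum v t) + (prefixSum v t - prefixSum u t)) = N := ⟨_, rfl⟩
  induction N using Nat.strong_induction_on generalizing u v with
  | _ N ih =>
  by_cases hall : ∀ t ≤ n, prefixSum u t = prefixSum v t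
  · simp [ext_of_vertexDeg_prefixSum hd hall]
  push Not at hall
  obtain ⟨t, ht, hne⟩ := hall
  wlog hlt : prefixSum v t < prefixSum u t generalizing u v
  · have := this (u := v) (v := u) (fun j => (hd j).symm)
      (fun j hj => (hz j (by rw [hd, hj])).symm) hn.symm
      (by rw [← hN]; exact Finset.sum_congr rfl fun _ _ => add_comm _ _) hne.symm
      (by omega)
    simpa using (pathIdeal k n).neg_mem this
  obtain ⟨r, hr, hx, hy, hr'⟩ := exists_exchange hd hz hn t ht hlt
  obtain ⟨w, rfl⟩ := exists_add_of_le (single_add_single_le Sum.inl_ne_inr hx hy)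
  rw [add_comm _ w] at *
  set u' := w + (Finsupp.single (Sum.inl ⟨r + 1, hr⟩) 1 + Finsupp.single (Sum.inr r) 1) with hu'
  set u := w + (Finsupp.single (Sum.inl r) 1 + Finsupp.single (Sum.inr ⟨r + 1, hr⟩) 1) with hu
  have hdu (j : Fin n) : vertexDeg u' j = vertexDeg u j := by
    simp only [hu, hu', vertexDeg_add, vertexDeg_single_inl, vertexDeg_single_inr]
    omega
  have hS (s : ℕ) (hs : s ≠ r + 1) : prefixSum u' s = prefixSum u s := by
    simp only [hu, hu', prefixSum_add, prefixSum_single_inl, prefixSum_single_inr]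
    split_ifs <;> omega
  have hS' : prefixSum u (r + 1) = prefixSum u' (r + 1) + 1 := by
    simp only [hu, hu', prefixSum_add, prefixSum_single_inl, prefixSum_single_inr]
    split_ifs <;> omega
  have step : monomial u (1 : k) - monomial u' 1 ∈ pathIdeal k n := by
    rw [← monomial_mul_delta]
    exact Ideal.mul_mem_left _ _ (Ideal.subset_span ⟨r, hr, rfl⟩)
  have rest : monomial u' (1 : k) - monomial v 1 ∈ pathIdeal k n := by
    refine ih _ ?_ (fun j => (hdu j).trans (hd j)) ?_ (by rw [hS n (by omega), hn]) rfl
    · rw [← hN]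
      refine Finset.sum_lt_sum (fun s _ => ?_)
        ⟨r + 1, Finset.mem_range.2 (by omega), by omega⟩
      rcases eq_or_ne s (r + 1) with rfl | hs
      · omega
      · rw [hS s hs]
    · intro j hj
      rw [hdu] at hj
      rw [hS j fun h => ?_, hz j hj]
      have := hz j hj
      rw [h] at this
      omega
  simpa using (pathIdeal k n).add_mem step rest

/-- A congruence criterion when all interior vertices occur. -/
lemma monomial_sub_mem_pathIdeal_of_interior {u v : Fin n ⊕ Fin n →₀ ℕ}
    (hd : ∀ j, vertexDeg u j = vertexDeg v j)
    (hint : ∀ j : Fin n, 0 < (j : ℕ) → (j : ℕ) + 2 ≤ n → vertexDeg u j ≠ 0)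
    (hn : prefixSum u n = prefixSum v n) :
    monomial u (1 : k) - monomial v 1 ∈ pathIdeal k n := by
  refine monomial_sub_mem_pathIdeal k hd (fun j hj => ?_) hn
  rcases Nat.eq_zero_or_pos j with h0 | h0
  · simp [h0, prefixSum_zero]
  have hlast : (j : ℕ) + 1 = n := by
    by_contra h
    exact hint j h0 (by omega) hj
  have h1 := prefixSum_succ u j
  have h2 := prefixSum_succ v j
  have h3 := hd j
  rw [hlast] at h1 h2
  simp only [vertexDeg] at hj h3
  omega

end Congruence

section Monomials

variable (k : Type) [Field k] {n : ℕ}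

/-- The exponent vector of `zfull k n l`. -/
noncomputable def zExp (n l : ℕ) : Fin n ⊕ Fin n →₀ ℕ :=
  Finsupp.equivFunOnFinite.symm (Sum.elim
    (fun t : Fin n => if 0 < (t : ℕ) ∧ (t : ℕ) + l + 2 ≤ n then 1 else 0)
    (fun t : Fin n => if n ≤ (t : ℕ) + l + 1 ∧ (t : ℕ) + 2 ≤ n then 1 else 0))

lemma zfull_eq_monomial (l : ℕ) : zfull k n l = monomial (zExp n l) 1 := by
  rw [monomial_eq, Finsupp.prod_fintype _ _ (by simp), Fintype.prod_sum_type]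
  simp [zfull, zExp, Finset.prod_filter, pow_ite]

lemma vertexDeg_zExp {l : ℕ} (hl : l ≤ n - 2) (j : Fin n) :
    vertexDeg (zExp n l) j = if 0 < (j : ℕ) ∧ (j : ℕ) + 2 ≤ n then 1 else 0 := by
  simp only [vertexDeg, zExp, Finsupp.equivFunOnFinite_symm_apply_apply, Sum.elim_inl,
    Sum.elim_inr]
  split_ifs <;> omega

lemma card_filter_interior (m : ℕ) (hm : m < n) :
    (Finset.univ.filter fun t : Fin n => 0 < (t : ℕ) ∧ (t : ℕ) ≤ m).card = m := by
  have : (Finset.univ.filter fun t : Fin n => 0 < (t : ℕ) ∧ (t : ℕ) ≤ m).map Fin.valEmbedding =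
      Finset.Ioc 0 m := by
    ext i
    simp only [Finset.mem_map, Finset.mem_filter, Finset.mem_univ, true_and, Fin.valEmbedding_apply,
      Finset.mem_Ioc]
    exact ⟨by rintro ⟨a, h, rfl⟩; exact h, fun h => ⟨⟨i, by omega⟩, h, rfl⟩⟩
  rw [← Finset.card_map, this]
  simp

lemma prefixSum_zExp (hn : 2 ≤ n) (l : ℕ) :
    prefixSum (zExp n l) n = n - 2 - l := by
  rw [prefixSum_card]
  simp only [zExp, Finsupp.equivFunOnFinite_symm_apply_apply, Sum.elim_inl]
  rw [← Finset.card_filter, ← card_filter_interior (n := n) (n - 2 - l) (by omega)]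
  congr 1
  ext t
  simp only [Finset.mem_filter, Finset.mem_univ, true_and]
  omega

lemma zfull_mul_delta_mem {l : ℕ} (hl : l ≤ n - 2) (i j : Fin n) :
    zfull k n l * delta k n i j ∈ pathIdeal k n := by
  rw [zfull_eq_monomial, monomial_mul_delta]
  refine monomial_sub_mem_pathIdeal_of_interior k (fun t => ?_) (fun t h1 h2 => ?_) ?_
  · simp only [vertexDeg_add, vertexDeg_single_inl, vertexDeg_single_inr]
    omega
  · rw [vertexDeg_add, vertexDeg_zExp hl, if_pos ⟨h1, h2⟩]
    omega
  · simp [prefixSum_add, prefixSum_single_inl, prefixSum_single_inr]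

lemma monomial_mem_of_interior (hn : 2 ≤ n) {u : Fin n ⊕ Fin n →₀ ℕ}
    (hint : ∀ j : Fin n, 0 < (j : ℕ) → (j : ℕ) + 2 ≤ n → vertexDeg u j ≠ 0) :
    monomial u (1 : k) ∈ pathIdeal k n ⊔ Ideal.span {f | ∃ l ≤ n - 2, f = zfull k n l} := by
  classical
  let I : Finset (Fin n) := Finset.univ.filter fun t => 0 < (t : ℕ) ∧ (t : ℕ) + 2 ≤ n
  have hI : I.card = n - 2 := by
    rw [← card_filter_interior (n := n) (n - 2) (by omega)]
    congr 1
    ext t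
    simp only [I, Finset.mem_filter, Finset.mem_univ, true_and]
    omega
  set l := (I.filter fun t => ¬ 0 < u (Sum.inl t)).card with hl
  have hln : l ≤ n - 2 := hI ▸ Finset.card_filter_le _ _
  have hpos : (I.filter fun t => 0 < u (Sum.inl t)).card = n - 2 - l := by
    have := Finset.card_filter_add_card_filter_not (s := I) (fun t => 0 < u (Sum.inl t))
    omega
  have hIx : (Finset.univ.filter fun t => t ∈ I ∧ 0 < u (Sum.inl t)).card =
      (I.filter fun t => 0 < u (Sum.inl t)).card := by
    congr 1
    ext t
    simp
  let w : Fin n ⊕ Fin n →₀ ℕ := Finsupp.equivFunOnFinite.symm (Sum.elim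
    (fun t => u (Sum.inl t) - if t ∈ I ∧ 0 < u (Sum.inl t) then 1 else 0)
    (fun t => u (Sum.inr t) - if t ∈ I ∧ ¬ 0 < u (Sum.inl t) then 1 else 0))
  have hcong : monomial u (1 : k) - monomial (zExp n l + w) 1 ∈ pathIdeal k n := by
    refine monomial_sub_mem_pathIdeal_of_interior k (fun t => ?_) hint ?_
    · rw [vertexDeg_add, vertexDeg_zExp hln]
      have := hint t
      simp only [vertexDeg, w, Finsupp.equivFunOnFinite_symm_apply_apply, Sum.elim_inl,
        Sum.elim_inr, I, Finset.mem_filter, Finset.mem_univ, true_and] at this ⊢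
      split_ifs <;> omega
    · rw [prefixSum_add, prefixSum_zExp hn l, ← hpos, prefixSum_card, prefixSum_card,
        ← hIx, Finset.card_filter, ← Finset.sum_add_distrib]
      refine Finset.sum_congr rfl fun t _ => ?_
      simp only [w, Finsupp.equivFunOnFinite_symm_apply_apply, Sum.elim_inl]
      split_ifs <;> omega
  have hz : monomial (zExp n l + w) (1 : k) ∈
      Ideal.span {f | ∃ l ≤ n - 2, f = zfull k n l} := by
    have : monomial (zExp n l + w) (1 : k) = monomial w 1 * zfull k n l := by
      rw [zfull_eq_monomial, monomial_mul, add_comm, one_mul]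
    rw [this]
    exact Ideal.mul_mem_left _ _ (Ideal.subset_span ⟨l, hln, rfl⟩)
  simpa using Ideal.add_mem _ (Ideal.mem_sup_left hcong) (Ideal.mem_sup_right hz)

end Monomials

section Parametrization

variable (k : Type) [Field k] {n : ℕ}

/-- Exponents of the images of the variables under `breakHom`. -/
noncomputable def breakExpVar (T : Finset ℕ) : Fin n ⊕ Fin n → (Fin n ⊕ ℕ →₀ ℕ) :=
  Sum.elim
    (fun j => Finsupp.single (Sum.inl j) 1 +
      ∑ t ∈ T with (j : ℕ) < t, Finsupp.single (Sum.inr t) 1)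
    (fun j => Finsupp.single (Sum.inl j) 1)

/-- The exponent recording the multidegree of `u` and its prefix sums at the places of `T`. -/
noncomputable def breakExp (T : Finset ℕ) (u : Fin n ⊕ Fin n →₀ ℕ) : Fin n ⊕ ℕ →₀ ℕ :=
  ∑ i, u i • breakExpVar T i

lemma breakExp_inl (T : Finset ℕ) (u : Fin n ⊕ Fin n →₀ ℕ) (j : Fin n) :
    breakExp T u (Sum.inl j) = vertexDeg u j := by
  simp [breakExp, breakExpVar, vertexDeg, Finsupp.single_apply]

lemma breakExp_inr (T : Finset ℕ) (u : Fin n ⊕ Fin n →₀ ℕ) (t : ℕ) :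
    breakExp T u (Sum.inr t) = if t ∈ T then prefixSum u t else 0 := by
  by_cases ht : t ∈ T
  · rw [prefixSum, Finset.sum_filter]
    simp [breakExp, breakExpVar, Finsupp.single_apply, ht]
  · simp [breakExp, breakExpVar, Finsupp.single_apply, ht]

/-- The homomorphism killing the variables at the vertices in `T` and sending the other `x_j` to
`s_j ∏_{t ∈ T, j < t} q_t` and the other `y_j` to `s_j`. It annihilates the path ideal. -/
noncomputable def breakHom (T : Finset ℕ) :
    MvPolynomial (Fin n ⊕ Fin n) k →ₐ[k] MvPolynomial (Fin n ⊕ ℕ) k :=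
  aeval fun i => if (Sum.elim id id i : Fin n).val ∈ T then 0 else monomial (breakExpVar T i) 1

lemma breakHom_delta_succ (T : Finset ℕ) (t : Fin n) (h : (t : ℕ) + 1 < n) :
    breakHom k T (delta k n t ⟨t + 1, h⟩) = 0 := by
  simp only [breakHom, delta, map_sub, map_mul, aeval_X, Sum.elim_inl, Sum.elim_inr, id]
  by_cases h1 : (t : ℕ) ∈ T
  · simp [h1]
  by_cases h2 : (t : ℕ) + 1 ∈ T
  · simp [h2]
  have : (T.filter fun s => (t : ℕ) < s) = T.filter fun s => (t : ℕ) + 1 < s := by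
    refine Finset.filter_congr fun s hs => ?_
    have : s ≠ t + 1 := fun h => h2 (h ▸ hs)
    omega
  simp only [h1, h2, if_false, monomial_mul, breakExpVar, Sum.elim_inl, Sum.elim_inr, this]
  rw [sub_eq_zero, add_rotate, add_comm (Finset.sum _ _)]

lemma breakHom_eq_zero_of_mem (T : Finset ℕ) {f : MvPolynomial (Fin n ⊕ Fin n) k}
    (hf : f ∈ pathIdeal k n) : breakHom k T f = 0 := by
  have : pathIdeal k n ≤ RingHom.ker (breakHom k T) := by
    refine Ideal.span_le.2 ?_
    rintro _ ⟨t, h, rfl⟩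
    exact breakHom_delta_succ k T t h
  exact this hf

lemma breakHom_delta_ne_zero {T : Finset ℕ} {i j : Fin n} (hi : (i : ℕ) ∉ T) (hj : (j : ℕ) ∉ T)
    {t : ℕ} (ht : t ∈ T) (hit : (i : ℕ) < t) (htj : t ≤ j) :
    breakHom k T (delta k n i j) ≠ 0 := by
  simp only [breakHom, delta, map_sub, map_mul, aeval_X, Sum.elim_inl, Sum.elim_inr, id, hi, hj,
    if_false, monomial_mul, mul_one]
  rw [sub_ne_zero]
  intro h
  have := DFunLike.congr_fun (monomial_left_injective one_ne_zero h) (Sum.inr t)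
  simp [breakExpVar, Finsupp.single_apply, ht, hit, htj] at this

lemma breakHom_monomial (T : Finset ℕ) (u : Fin n ⊕ Fin n →₀ ℕ) (c : k) :
    breakHom k T (monomial u c) =
      if ∀ j : Fin n, (j : ℕ) ∈ T → vertexDeg u j = 0 then monomial (breakExp T u) c else 0 := by
  rw [breakHom, aeval_monomial, Finsupp.prod_fintype _ _ (by simp)]
  split_ifs with h
  · have (i : Fin n ⊕ Fin n) :
        (if (Sum.elim id id i : Fin n).val ∈ T then 0
          else monomial (breakExpVar T i) (1 : k)) ^ u i = monomial (u i • breakExpVar T i) 1 := by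
      split_ifs with hi
      · have : u i = 0 := by
          have := h _ hi
          rcases i with i | i <;> simp [vertexDeg] at this <;> simp [this]
        simp [this]
      · rw [monomial_pow, one_pow]
    simp only [this]
    rw [← monomial_sum_one, algebraMap_eq, C_mul_monomial, mul_one, breakExp]
  · push Not at h
    obtain ⟨j, hj, hne⟩ := h
    have : ∃ i : Fin n ⊕ Fin n, Sum.elim id id i = j ∧ u i ≠ 0 := by
      by_cases hx : u (Sum.inl j) = 0
      · exact ⟨Sum.inr j, rfl, by simpa [vertexDeg, hx] using hne⟩
      · exact ⟨Sum.inl j, rfl, hx⟩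
    obtain ⟨i, rfl, hi⟩ := this
    rw [Finset.prod_eq_zero (Finset.mem_univ i), mul_zero]
    rw [if_pos hj, zero_pow hi]

/-- The interior vertices missing from the support of `u`, together with `n`. -/
def breakSet (u : Fin n ⊕ Fin n →₀ ℕ) : Finset ℕ :=
  insert n ((Finset.univ.filter fun j : Fin n =>
    0 < (j : ℕ) ∧ (j : ℕ) + 2 ≤ n ∧ vertexDeg u j = 0).map Fin.valEmbedding)

lemma mem_breakSet {u : Fin n ⊕ Fin n →₀ ℕ} {j : Fin n} :
    (j : ℕ) ∈ breakSet u ↔ 0 < (j : ℕ) ∧ (j : ℕ) + 2 ≤ n ∧ vertexDeg u j = 0 := by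
  have : (j : ℕ) ≠ n := by omega
  simp [breakSet, this, ← Fin.ext_iff]

lemma card_mem_breakSet (u : Fin n ⊕ Fin n →₀ ℕ) : n ∈ breakSet u :=
  Finset.mem_insert_self _ _

lemma vertexDeg_eq_zero_of_mem_breakSet {u : Fin n ⊕ Fin n →₀ ℕ} (j : Fin n)
    (hj : (j : ℕ) ∈ breakSet u) : vertexDeg u j = 0 :=
  (mem_breakSet.1 hj).2.2

lemma breakSet_congr {u v : Fin n ⊕ Fin n →₀ ℕ} (h : ∀ j, vertexDeg u j = vertexDeg v j) :
    breakSet u = breakSet v := by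
  simp only [breakSet, h]

lemma vertexDeg_eq_of_breakExp_eq {S T : Finset ℕ} {u v : Fin n ⊕ Fin n →₀ ℕ}
    (h : breakExp S u = breakExp T v) (j : Fin n) : vertexDeg u j = vertexDeg v j := by
  rw [← breakExp_inl S, ← breakExp_inl T, h]

lemma monomial_sub_mem_of_breakExp_eq {u v : Fin n ⊕ Fin n →₀ ℕ}
    (h : breakExp (breakSet u) u = breakExp (breakSet v) v) :
    monomial u (1 : k) - monomial v 1 ∈ pathIdeal k n := by
  have hd := vertexDeg_eq_of_breakExp_eq h
  have hS {t : ℕ} (ht : t ∈ breakSet u) : prefixSum u t = prefixSum v t := by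
    have := DFunLike.congr_fun h (Sum.inr t)
    rwa [← breakSet_congr hd, breakExp_inr, breakExp_inr, if_pos ht, if_pos ht] at this
  have hn := hS (card_mem_breakSet u)
  refine monomial_sub_mem_pathIdeal k hd (fun j hj => ?_) hn
  rcases Nat.eq_zero_or_pos j with h0 | h0
  · simp [h0, prefixSum_zero]
  by_cases hlast : (j : ℕ) + 1 = n
  · have h1 := prefixSum_succ u j
    have h2 := prefixSum_succ v j
    have h3 := hd j
    rw [hlast] at h1 h2
    simp only [vertexDeg] at hj h3
    omega
  · exact hS (mem_breakSet.2 ⟨h0, by omega, hj⟩)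

lemma coeff_breakHom (f : MvPolynomial (Fin n ⊕ Fin n) k) (v : Fin n ⊕ Fin n →₀ ℕ) :
    coeff (breakExp (breakSet v) v) (breakHom k (breakSet v) f) =
      ∑ u ∈ f.support with breakExp (breakSet u) u = breakExp (breakSet v) v, coeff u f := by
  classical
  conv_lhs => rw [f.as_sum, map_sum, coeff_sum]
  rw [Finset.sum_filter]
  refine Finset.sum_congr rfl fun u _ => ?_
  rw [breakHom_monomial]
  by_cases hd : ∀ j, vertexDeg u j = vertexDeg v j
  · rw [if_pos fun j hj => (hd j).trans (vertexDeg_eq_zero_of_mem_breakSet j hj), coeff_monomial,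
      breakSet_congr hd]
  · rw [if_neg fun h => hd (vertexDeg_eq_of_breakExp_eq h)]
    split_ifs
    · rw [coeff_monomial, if_neg fun h => hd (vertexDeg_eq_of_breakExp_eq h)]
    · simp

lemma mem_pathIdeal_of_breakHom_eq_zero {f : MvPolynomial (Fin n ⊕ Fin n) k}
    (hf : ∀ u ∈ f.support, breakHom k (breakSet u) f = 0) : f ∈ pathIdeal k n := by
  classical
  rw [f.as_sum, ← Finset.sum_fiberwise_of_maps_to
    (g := fun u => breakExp (breakSet u) u) (t := f.support.image _)
    (fun u hu => Finset.mem_image_of_mem _ hu)]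
  refine Ideal.sum_mem _ fun κ hκ => ?_
  obtain ⟨v, hv, rfl⟩ := Finset.mem_image.1 hκ
  have hsum := coeff_breakHom k f v
  rw [hf v hv, coeff_zero] at hsum
  have : ∑ u ∈ f.support with breakExp (breakSet u) u = breakExp (breakSet v) v,
        monomial u (coeff u f) =
      ∑ u ∈ f.support with breakExp (breakSet u) u = breakExp (breakSet v) v,
        C (coeff u f) * (monomial u 1 - monomial v 1) := by
    simp only [mul_sub, C_mul_monomial, mul_one, Finset.sum_sub_distrib]
    rw [← map_sum (monomial v), ← hsum, map_zero, sub_zero]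
  rw [this]
  refine Ideal.sum_mem _ fun u hu => Ideal.mul_mem_left _ _ ?_
  exact monomial_sub_mem_of_breakExp_eq k (Finset.mem_filter.1 hu).2

end Parametrization

lemma mem_of_mul_delta_mem (k : Type) [Field k] {n : ℕ} (hn : 2 ≤ n)
    {f : MvPolynomial (Fin n ⊕ Fin n) k}
    (hf : f * delta k n ⟨0, by omega⟩ ⟨n - 1, by omega⟩ ∈ pathIdeal k n) :
    f ∈ pathIdeal k n ⊔ Ideal.span {f | ∃ l ≤ n - 2, f = zfull k n l} := by
  classical
  set interior : (Fin n ⊕ Fin n →₀ ℕ) → Prop := fun u =>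
    ∀ j : Fin n, 0 < (j : ℕ) → (j : ℕ) + 2 ≤ n → vertexDeg u j ≠ 0 with hint
  set g := ∑ u ∈ f.support with interior u, monomial u (coeff u f) with hg
  have hgmem : g ∈ pathIdeal k n ⊔ Ideal.span {f | ∃ l ≤ n - 2, f = zfull k n l} := by
    refine Ideal.sum_mem _ fun u hu => ?_
    rw [← mul_one (coeff u f), ← C_mul_monomial]
    exact Ideal.mul_mem_left _ _ (monomial_mem_of_interior k hn (Finset.mem_filter.1 hu).2)
  have hsub : f - g = ∑ u ∈ f.support with ¬ interior u, monomial u (coeff u f) := by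
    rw [sub_eq_iff_eq_add', hg, Finset.sum_filter_add_sum_filter_not, ← f.as_sum]
  have hfg : f - g ∈ pathIdeal k n := by
    refine mem_pathIdeal_of_breakHom_eq_zero k fun u hu => ?_
    have hu' : ¬ interior u := by
      rw [hsub] at hu
      obtain ⟨v, hv, hvu⟩ := Finset.mem_biUnion.1 (support_sum hu)
      rw [Finset.mem_singleton.1 (support_monomial_subset hvu)]
      exact (Finset.mem_filter.1 hv).2
    simp only [hint] at hu'
    push Not at hu'
    obtain ⟨j, hj0, hjn, hj⟩ := hu'
    have hjT : (j : ℕ) ∈ breakSet u := mem_breakSet.2 ⟨hj0, hjn, hj⟩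
    have hδ : breakHom k (breakSet u) (delta k n ⟨0, by omega⟩ ⟨n - 1, by omega⟩) ≠ 0 := by
      refine breakHom_delta_ne_zero k ?_ ?_ hjT hj0 ?_
      · rw [mem_breakSet]; simp
      · rw [mem_breakSet]; simp only; omega
      · simp only; omega
    have hf0 : breakHom k (breakSet u) f = 0 := by
      have := breakHom_eq_zero_of_mem k (breakSet u) hf
      rw [map_mul] at this
      exact (mul_eq_zero.1 this).resolve_right hδ
    have hg0 : breakHom k (breakSet u) g = 0 := by
      rw [hg, map_sum]
      refine Finset.sum_eq_zero fun v hv => ?_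
      rw [breakHom_monomial, if_neg fun h => ?_]
      exact (Finset.mem_filter.1 hv).2 j hj0 hjn (h j hjT)
    rw [map_sub, hf0, hg0, sub_zero]
  simpa using Ideal.add_mem _ (Ideal.mem_sup_left hfg) hgmem

/-- Let `k` have prime characteristic `p > 0` and let `G` be a
Hamiltonian graph on `n ≥ 3` vertices containing the cycle `C_n` (with edges
`{t, t+1}` together with the edge joining the first and last vertex).  With `g = J(G)` and
`a = J(P_n)`, the colon ideal satisfies `(a : g) = a + (z_0, z_1, …, z_{n−2})`. -/
theorem stmt16 (n : ℕ) (hn : 3 ≤ n) (k : Type) [Field k] (p : ℕ) (hp : p.Prime)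
    [CharP k p] (G : SimpleGraph (Fin n))
    (hpath : ∀ (t : Fin n) (h : (t : ℕ) + 1 < n), G.Adj t ⟨(t : ℕ) + 1, h⟩)
    (hcyc : G.Adj ⟨0, by omega⟩ ⟨n - 1, by omega⟩) :
    Submodule.colon (pathIdeal k n) (beIdeal k n G) =
      pathIdeal k n ⊔ Ideal.span {f | ∃ l ≤ n - 2, f = zfull k n l} := by
  apply le_antisymm
  · intro f hf
    exact mem_of_mul_delta_mem k (by omega)
      (Submodule.mem_colon.1 hf _ (Ideal.subset_span ⟨_, _, hcyc, rfl⟩))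
  · refine sup_le Ideal.le_colon (Ideal.span_le.2 ?_)
    rintro _ ⟨l, hl, rfl⟩
    refine Submodule.mem_colon.2 fun g hg => ?_
    induction hg using Submodule.span_induction with
    | mem g hg =>
      obtain ⟨i, j, -, rfl⟩ := hg
      exact zfull_mul_delta_mem k hl i j
    | zero => simp
    | add g h _ _ hg hh => rw [smul_add]; exact Ideal.add_mem _ hg hh
    | smul r g _ hg => rw [smul_comm]; exact Ideal.mul_mem_left _ r hg
end

section
/- Let k be a field of prime characteristic p > 0, let n ≥ 3, and let G be a Hamiltonian graph on n vertices with g = J(G). Then the set of associated primes of the local cohomology module H^{n−1}_g(R) is exactly {J(K_n)}, where K_n is the complete graph on the n vertices. -/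
open MvPolynomial

section
open MonomialOrder

/-- Every polynomial is congruent modulo the ideal generated by a list of nonzero polynomials to a
polynomial none of whose monomials is divisible by one of the leading monomials. -/
theorem exists_normalForm {σ k : Type*} [Field k] (m : MonomialOrder σ)
    (rs : List (MvPolynomial σ k)) (h0 : ∀ f ∈ rs, f ≠ 0) (g : MvPolynomial σ k) :
    ∃ r, g - r ∈ Ideal.ofList rs ∧ ∀ c ∈ r.support, ∀ f ∈ rs, ¬ m.degree f ≤ c := by
  obtain ⟨q, r, hq, -, hr⟩ := m.div_set (B := {f | f ∈ rs})
    (fun b hb => (m.leadingCoeff_ne_zero_iff.mpr (h0 b hb)).isUnit) g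
  refine ⟨r, ?_, hr⟩
  rw [hq, add_sub_cancel_right, Ideal.ofList, Ideal.span]
  refine (Finsupp.mem_span_iff_linearCombination _ _ _).mpr ⟨q, rfl⟩

theorem le_of_le_add_of_disjoint {σ : Type*} {a b c : σ →₀ ℕ} (h : a ≤ b + c)
    (hd : Disjoint c.support a.support) : a ≤ b := by
  intro i
  have hi := h i
  by_cases ha : a i = 0
  · simp [ha]
  · have : c i = 0 := by
      by_contra hc
      exact Finset.disjoint_left.mp hd (Finsupp.mem_support_iff.mpr hc)
        (Finsupp.mem_support_iff.mpr ha)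
    simpa [this] using hi

/-- Polynomials whose leading monomials are pairwise coprime form a Gröbner basis. -/
theorem exists_degree_le_of_mem_ofList {σ k : Type*} [Field k] (m : MonomialOrder σ)
    (rs : List (MvPolynomial σ k)) (h0 : ∀ f ∈ rs, f ≠ 0)
    (hd : rs.Pairwise fun f g => Disjoint (m.degree f).support (m.degree g).support) :
    ∀ h ∈ Ideal.ofList rs, h ≠ 0 → ∃ f ∈ rs, m.degree f ≤ m.degree h := by
  induction rs with
  | nil => simp +contextual
  | cons f rs ih =>
    intro h hh hne
    rw [List.pairwise_cons] at hd
    have h0' : ∀ f ∈ rs, f ≠ 0 := fun f hf => h0 f (List.mem_cons_of_mem _ hf)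
    have hf0 : f ≠ 0 := h0 f List.mem_cons_self
    specialize ih h0' hd.2
    rw [Ideal.ofList_cons, Submodule.mem_sup] at hh
    obtain ⟨u, hu, r, hr, rfl⟩ := hh
    obtain ⟨g, rfl⟩ := Ideal.mem_span_singleton'.mp hu
    obtain ⟨g', hg, hg'⟩ := exists_normalForm m rs h0' g
    set r' := (g - g') * f + r with hr'
    have hr'm : r' ∈ Ideal.ofList rs := add_mem (Ideal.mul_mem_right _ _ hg) hr
    have key : g * f + r = g' * f + r' := by rw [hr']; ring
    rw [key] at hne ⊢
    by_cases hg0 : g' = 0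
    · simp only [hg0, zero_mul, zero_add] at hne ⊢
      obtain ⟨b, hb, hb'⟩ := ih r' hr'm hne
      exact ⟨b, List.mem_cons_of_mem _ hb, hb'⟩
    have hdeg : m.degree (g' * f) = m.degree g' + m.degree f := m.degree_mul hg0 hf0
    have hnot : ∀ b ∈ rs, ¬ m.degree b ≤ m.degree (g' * f) := by
      intro b hb hle
      rw [hdeg] at hle
      exact hg' _ (m.degree_mem_support hg0) b hb (le_of_le_add_of_disjoint hle (hd.1 b hb))
    rcases lt_trichotomy (m.toSyn (m.degree (g' * f))) (m.toSyn (m.degree r')) with hlt | heq | hlt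
    · rw [m.degree_add_eq_right_of_lt hlt]
      have hr0 : r' ≠ 0 := by
        rintro h
        rw [h, m.degree_zero, map_zero] at hlt
        exact absurd hlt (not_lt_of_ge (m.zero_le _))
      obtain ⟨b, hb, hb'⟩ := ih r' hr'm hr0
      exact ⟨b, List.mem_cons_of_mem _ hb, hb'⟩
    · have heq' := m.toSyn.injective heq
      by_cases hr0 : r' = 0
      · rw [hr0, add_zero, hdeg]
        exact ⟨f, List.mem_cons_self, le_add_self⟩
      · obtain ⟨b, hb, hb'⟩ := ih r' hr'm hr0
        exact absurd (heq' ▸ hb') (hnot b hb)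
    · rw [m.degree_add_of_lt hlt, hdeg]
      exact ⟨f, List.mem_cons_self, le_add_self⟩

/-- Polynomials whose leading monomials are pairwise coprime form a weakly regular sequence. -/
theorem isWeaklyRegular_of_disjoint_degree {σ k : Type*} [Field k] (m : MonomialOrder σ)
    (rs : List (MvPolynomial σ k)) (h0 : ∀ f ∈ rs, f ≠ 0)
    (hd : rs.Pairwise fun f g => Disjoint (m.degree f).support (m.degree g).support) :
    RingTheory.Sequence.IsWeaklyRegular (MvPolynomial σ k) rs := by
  refine ⟨fun i hi => ?_⟩
  have hsub : (rs.take i).Sublist rs := List.take_sublist _ _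
  have h0' : ∀ f ∈ rs.take i, f ≠ 0 := fun f hf => h0 f (hsub.subset hf)
  have hpre : (rs.take i).Pairwise
      fun f g => Disjoint (m.degree f).support (m.degree g).support := hd.sublist hsub
  have hdis : ∀ b ∈ rs.take i, Disjoint (m.degree rs[i]).support (m.degree b).support := by
    intro b hb
    obtain ⟨j, hj, rfl⟩ := List.mem_take_iff_getElem.mp hb
    exact (List.pairwise_iff_getElem.mp hd j i (by omega) hi (by omega)).symm
  have hfi : rs[i] ≠ 0 := h0 _ (List.getElem_mem hi)
  generalize rs[i] = f at *
  generalize rs.take i = ts at *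
  rw [isSMulRegular_iff_right_eq_zero_of_smul]
  intro x hx
  obtain ⟨g, rfl⟩ := Submodule.mkQ_surjective _ x
  rw [← map_smul] at hx
  simp only [Submodule.mkQ_apply, Submodule.Quotient.mk_eq_zero, smul_eq_mul, Ideal.mul_top] at hx ⊢
  obtain ⟨r, hr, hr'⟩ := exists_normalForm m ts h0' g
  have hrf : f * r ∈ Ideal.ofList ts := by
    have := sub_mem hx (Ideal.mul_mem_left _ f hr)
    convert this using 1
    ring
  by_cases hr0 : r = 0
  · simpa [hr0] using hr
  obtain ⟨b, hb, hb'⟩ := exists_degree_le_of_mem_ofList m ts h0' hpre _ hrf (mul_ne_zero hfi hr0)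
  rw [m.degree_mul hfi hr0, add_comm] at hb'
  exact absurd (le_of_le_add_of_disjoint hb' (hdis b hb)) (hr' _ (m.degree_mem_support hr0) b hb)

end

section
open CategoryTheory Abelian RingTheory.Sequence

universe u

theorem ext_smul_eq_zero {R : Type u} [CommRing R] {N M : ModuleCat.{u} R} {r : R}
    (hr : ∀ x : N, r • x = 0) {i : ℕ} (x : Ext N M i) : r • x = 0 := by
  have h : r • 𝟙 N = 0 := by
    ext x
    exact hr x
  rw [← Ext.mk₀_id_comp x, ← Ext.smul_comp, ← Ext.mk₀_smul, h, Ext.mk₀_zero, Ext.zero_comp]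

theorem ext_comp_smulShortComplex_f {R : Type u} [CommRing R] {N M : ModuleCat.{u} R} {r : R}
    (hr : ∀ x : N, r • x = 0) {i : ℕ} (x : Ext N M i) :
    x.comp (Ext.mk₀ (M.smulShortComplex r).f) (add_zero i) = 0 := by
  have : x.comp (Ext.mk₀ (r • 𝟙 M)) (add_zero i) = 0 := by
    rw [Ext.mk₀_smul, Ext.comp_smul, Ext.comp_mk₀_id, ext_smul_eq_zero hr]
  exact this

theorem ext_subsingleton_of_isWeaklyRegular {R : Type u} [CommRing R] (N : ModuleCat.{u} R)
    (rs : List R) (hN : ∀ r ∈ rs, ∀ x : N, r • x = 0) (M : ModuleCat.{u} R)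
    (hM : IsWeaklyRegular M rs) : ∀ i < rs.length, Subsingleton (Ext N M i) := by
  induction rs generalizing M with
  | nil => simp
  | cons r rs ih =>
    rw [isWeaklyRegular_cons_iff] at hM
    have hS := hM.1.smulShortComplex_shortExact
    have hr := hN r List.mem_cons_self
    have ih' := ih (fun s hs => hN s (List.mem_cons_of_mem _ hs)) (ModuleCat.of R (QuotSMulTop r M))
      hM.2
    rintro (_ | i) hi
    · refine subsingleton_of_forall_eq 0 fun x => ?_
      obtain ⟨f, rfl⟩ := (Ext.mk₀_bijective N M).2 x
      have := hS.mono_f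
      have h0 := ext_comp_smulShortComplex_f hr (Ext.mk₀ f)
      erw [Ext.mk₀_comp_mk₀, Ext.mk₀_eq_zero_iff] at h0
      rw [Ext.mk₀_eq_zero_iff]
      exact (cancel_mono (M.smulShortComplex r).f).mp (h0.trans Limits.zero_comp.symm)
    · refine subsingleton_of_forall_eq 0 fun x => ?_
      obtain ⟨y, hy⟩ := Ext.covariant_sequence_exact₁ N hS x (ext_comp_smulShortComplex_f hr x) rfl
      have : Subsingleton (Ext N (M.smulShortComplex r).X₃ i) := ih' i (by simpa using hi)
      rw [← hy, Subsingleton.elim y 0, Ext.zero_comp]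
      rfl

/-- Rees' theorem: if a weakly `M`-regular sequence `rs` of length `n` annihilates `N`, then
`Ext^n(N, M) ≃ Hom(N, M/(rs)M)`. -/
theorem ext_linearEquiv_of_isWeaklyRegular {R : Type u} [CommRing R] (N : ModuleCat.{u} R)
    (rs : List R) (hN : ∀ r ∈ rs, ∀ x : N, r • x = 0) (M : ModuleCat.{u} R)
    (hM : IsWeaklyRegular M rs) :
    Nonempty (Ext N M rs.length ≃ₗ[R] (N →ₗ[R] M ⧸ (Ideal.ofList rs • ⊤ : Submodule R M))) := by
  induction rs generalizing M with
  | nil =>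
    refine ⟨Ext.linearEquiv₀ ≪≫ₗ ModuleCat.homLinearEquiv ≪≫ₗ ?_⟩
    refine LinearEquiv.congrRight ?_
    exact (Submodule.quotEquivOfEqBot _ (by simp)).symm
  | cons r rs ih =>
    rw [isWeaklyRegular_cons_iff] at hM
    have hS := hM.1.smulShortComplex_shortExact
    have hr := hN r List.mem_cons_self
    have hN' := fun s hs => hN s (List.mem_cons_of_mem _ hs)
    obtain ⟨e⟩ := ih hN' (ModuleCat.of R (QuotSMulTop r M)) hM.2
    let δ : Ext N (ModuleCat.of R (QuotSMulTop r M)) rs.length →ₗ[R] Ext N M (rs.length + 1) :=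
      { toFun := fun x => x.comp hS.extClass rfl
        map_add' := fun x y => Ext.add_comp _ _ _ _
        map_smul' := fun a x => Ext.smul_comp _ _ _ _ }
    have hδ : Function.Bijective δ := by
      constructor
      · rw [injective_iff_map_eq_zero]
        intro x hx
        obtain ⟨y, hy⟩ := Ext.covariant_sequence_exact₃ N hS x rfl hx
        have : Subsingleton (Ext N (M.smulShortComplex r).X₂ rs.length) :=
          ext_subsingleton_of_isWeaklyRegular N (r :: rs) hN M
            ((isWeaklyRegular_cons_iff M r rs).mpr hM) rs.length (by simp)
        rw [← hy, Subsingleton.elim y 0, Ext.zero_comp]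
        rfl
      · intro x
        exact Ext.covariant_sequence_exact₁ N hS x (ext_comp_smulShortComplex_f hr x) rfl
    exact ⟨(LinearEquiv.ofBijective δ hδ).symm ≪≫ₗ e ≪≫ₗ
      LinearEquiv.congrRight (Submodule.quotOfListConsSMulTopEquivQuotSMulTopInner M r rs).symm⟩

theorem ext_eq_zero_of_epi_of_isWeaklyRegular {R : Type u} [CommRing R] {N' N M : ModuleCat.{u} R}
    (φ : N' ⟶ N) [Epi φ] {t : ℕ} (rs : List R) (hN : ∀ r ∈ rs, ∀ x : N', r • x = 0)
    (hM : IsWeaklyRegular M rs) (ht : rs.length = t + 1) (x : Ext N M (t + 1))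
    (hx : (Ext.mk₀ φ).comp x (zero_add _) = 0) : x = 0 := by
  have hS : (ShortComplex.mk (Limits.kernel.ι φ) φ (by simp)).ShortExact :=
    { exact := ShortComplex.exact_of_f_is_kernel _ (Limits.kernelIsKernel φ) }
  obtain ⟨y, hy⟩ := Ext.contravariant_sequence_exact₃ hS M x hx (add_comm 1 t)
  have hK : ∀ r ∈ rs, ∀ z : (Limits.kernel φ : ModuleCat R), r • z = 0 := by
    intro r hr z
    have hinj := (ModuleCat.mono_iff_injective (Limits.kernel.ι φ)).mp inferInstance
    exact hinj (by rw [map_smul, map_zero, hN r hr])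
  have := ext_subsingleton_of_isWeaklyRegular _ rs hK M hM t (by omega)
  have hy0 : y = 0 := Subsingleton.elim (α := Ext (Limits.kernel φ) M t) y 0
  rw [← hy, hy0, Ext.comp_zero]

end

section

open CategoryTheory Abelian Opposite

theorem homologyUnop_hom_naturality {ι V : Type*} [Category* V] [Limits.HasZeroMorphisms V]
    {c : ComplexShape ι}
    {K L : HomologicalComplex Vᵒᵖ c} (φ : K ⟶ L) (i : ι) [K.HasHomology i] [L.HasHomology i] :
    HomologicalComplex.homologyMap ((HomologicalComplex.unopFunctor V c).map φ.op) i ≫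
      (K.homologyUnop i).hom =
      (L.homologyUnop i).hom ≫ (HomologicalComplex.homologyMap φ i).unop := 
  congrArg Quiver.Hom.unop (HomologicalComplex.homologyOp_hom_naturality
    ((HomologicalComplex.unopFunctor V c).map φ.op) i).symm

theorem comp_inv_eq_of_comm {C : Type*} [Category* C] {A A' H H' U U' : C} (e : A ⟶ A')
    (i : A ⟶ H) (i' : A' ⟶ H') (m : H ⟶ H') (v : U ≅ H) (v' : U' ≅ H') (w : U ⟶ U')
    (h : e ≫ i' = i ≫ m) (h' : w ≫ v'.hom = v.hom ≫ m) :
    e ≫ i' ≫ v'.inv = (i ≫ v.inv) ≫ w := by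
  rw [← cancel_mono v'.hom]
  simp [h, h']

variable {R : Type u} [CommRing R]

theorem isoExt_naturality {X X' : ModuleCat.{u} R} (P : ProjectiveResolution X)
    (P' : ProjectiveResolution X')
    (Y : ModuleCat.{u} R) (n : ℕ) (g : X' ⟶ X) (φ : P'.Hom P g) :
    ((_root_.Ext R (ModuleCat.{u} R) n).map g.op).app Y ≫ (P'.isoExt (R := R) n Y).hom =
      (P.isoExt n Y).hom ≫ HomologicalComplex.homologyMap
        ((HomologicalComplex.unopFunctor _ _).map
          ((((linearYoneda R (ModuleCat.{u} R)).obj Y).rightOp.mapHomologicalComplex _).map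
            φ.hom).op) n := by
  have h := ProjectiveResolution.isoLeftDerivedObj_inv_naturality g P' P φ.hom
    (by simpa using φ.hom_f_zero_comp_π_f_zero) ((linearYoneda R (ModuleCat.{u} R)).obj Y).rightOp n
  have h' := congrArg Quiver.Hom.unop h
  have h2 := homologyUnop_hom_naturality
    ((((linearYoneda R (ModuleCat.{u} R)).obj Y).rightOp.mapHomologicalComplex _).map φ.hom) n
  exact comp_inv_eq_of_comm _ _ _ _ _ _ _ h' h2

theorem exists_iCycles_eq (K : CochainComplex (ModuleCat.{u} R) ℕ) (n : ℕ) (x : K.X n)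
    (hx : K.d n (n + 1) x = 0) : ∃ c : K.cycles n, K.iCycles n c = x := by
  have h : (ShortComplex.mk _ _ (K.iCycles_d n (n + 1))).Exact :=
    ShortComplex.exact_of_f_is_kernel _ (K.cyclesIsKernel n (n + 1) (by simp))
  rw [ShortComplex.moduleCat_exact_iff] at h
  exact h x hx

theorem homologyπ_eq_zero_iff (K : CochainComplex (ModuleCat.{u} R) ℕ) (q n : ℕ) (hn : q + 1 = n)
    (c : K.cycles n) : K.homologyπ n c = 0 ↔ ∃ y, K.d q n y = K.iCycles n c := by
  have hinj : Function.Injective (K.iCycles n) :=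
    (ModuleCat.mono_iff_injective _).mp inferInstance
  have h : (ShortComplex.mk _ _ (K.toCycles_comp_homologyπ q n)).Exact :=
    ShortComplex.exact_of_g_is_cokernel _ (K.homologyIsCokernel q n (by simp [← hn]))
  rw [ShortComplex.moduleCat_exact_iff] at h
  have hy : ∀ y, K.iCycles n (K.toCycles q n y) = K.d q n y := fun y =>
    ConcreteCategory.congr_hom (K.toCycles_i q n) y
  constructor
  · intro hc
    obtain ⟨y, rfl⟩ := h c hc
    exact ⟨y, (hy y).symm⟩
  · rintro ⟨y, hy'⟩
    rw [← hy] at hy'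
    rw [← hinj hy']
    exact ConcreteCategory.congr_hom (K.toCycles_comp_homologyπ q n) y

theorem exists_linearEquiv_ext (X : ModuleCat.{u} R) (P : ProjectiveResolution X)
    (Y : ModuleCat.{u} R) (q n : ℕ) (hn : q + 1 = n) :
    ∃ e : (((_root_.Ext R (ModuleCat.{u} R) n).obj (op X)).obj Y) ≃ₗ[R] Abelian.Ext X Y n,
      ∀ c : (P.complex.linearYonedaObj R Y).cycles n,
        e ((P.isoExt n Y).inv ((P.complex.linearYonedaObj R Y).homologyπ n c)) =
          P.extMk ((P.complex.linearYonedaObj R Y).iCycles n c) (n + 1) rfl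
            (ConcreteCategory.congr_hom ((P.complex.linearYonedaObj R Y).iCycles_d n (n + 1))
              c) := by
  set K := P.complex.linearYonedaObj R Y with hK
  let τ : K.cycles n → (P.complex.X n ⟶ Y) := fun c => K.iCycles n c
  have hτ : ∀ c, P.complex.d (n + 1) n ≫ τ c = 0 := fun c =>
    ConcreteCategory.congr_hom (K.iCycles_d n (n + 1)) c
  have τ_add : ∀ c d, τ (c + d) = τ c + τ d := fun c d => map_add (K.iCycles n).hom c d
  have τ_smul : ∀ (a : R) c, τ (a • c) = τ c ≫ (a • 𝟙 Y) := fun a c => by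
    rw [Linear.comp_smul, Category.comp_id]
    exact map_smul (K.iCycles n).hom a c
  let Ψ : K.cycles n →ₗ[R] Abelian.Ext X Y n :=
    { toFun c := P.extMk (τ c) (n + 1) rfl (hτ c)
      map_add' c d := by
        rw [P.add_extMk]
        congr 1
        exact τ_add c d
      map_smul' a c := by
        rw [RingHom.id_apply, Ext.smul_eq_comp_mk₀, P.extMk_comp_mk₀]
        congr 1
        exact τ_smul a c }
  let Φ : K.cycles n →ₗ[R] (((_root_.Ext R (ModuleCat.{u} R) n).obj (op X)).obj Y) :=
    (K.homologyπ n ≫ (P.isoExt n Y).inv).hom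
  have hΨ : Function.Surjective Ψ := by
    intro α
    obtain ⟨f, hf, rfl⟩ := P.extMk_surjective α (n + 1) rfl
    obtain ⟨c, hc⟩ := exists_iCycles_eq K n f hf
    refine ⟨c, ?_⟩
    change P.extMk (τ c) (n + 1) rfl (hτ c) = _
    congr 1
  have hΦ : Function.Surjective Φ := (ModuleCat.epi_iff_surjective _).mp inferInstance
  have hker : LinearMap.ker Φ = LinearMap.ker Ψ := by
    ext c
    rw [LinearMap.mem_ker, LinearMap.mem_ker]
    change _ ↔ P.extMk (τ c) (n + 1) rfl (hτ c) = 0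
    rw [P.extMk_eq_zero_iff _ _ _ _ q hn]
    refine Iff.trans ?_ (homologyπ_eq_zero_iff K q n hn c)
    exact (P.isoExt n Y).symm.toLinearEquiv.map_eq_zero_iff
  refine ⟨(Φ.quotKerEquivOfSurjective hΦ).symm ≪≫ₗ Submodule.quotEquivOfEq _ _ hker ≪≫ₗ
    Ψ.quotKerEquivOfSurjective hΨ, fun c => ?_⟩
  have h1 : (Φ.quotKerEquivOfSurjective hΦ).symm
      ((P.isoExt n Y).inv (K.homologyπ n c)) = Submodule.Quotient.mk c := by
    rw [LinearEquiv.symm_apply_eq]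
    rfl
  rw [LinearEquiv.trans_apply, LinearEquiv.trans_apply, h1]
  rfl

/-- The definition of `Ext` by derived functors of `Hom(-, Y)` agrees with `Abelian.Ext` in
positive degrees, linearly and naturally in the first variable. -/
theorem exists_linearEquiv_ext_natural (Y : ModuleCat.{u} R) (q n : ℕ) (hn : q + 1 = n) :
    ∃ e : ∀ X : ModuleCat.{u} R,
      (((_root_.Ext R (ModuleCat.{u} R) n).obj (op X)).obj Y) ≃ₗ[R] Abelian.Ext X Y n,
      ∀ (X X' : ModuleCat.{u} R) (g : X' ⟶ X) (z),
        e X' (((_root_.Ext R (ModuleCat.{u} R) n).map g.op).app Y z) =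
          (Ext.mk₀ g).comp (e X z) (zero_add n) := by
  choose e he using fun X : ModuleCat.{u} R =>
    exists_linearEquiv_ext X (projectiveResolution X) Y q n hn
  refine ⟨e, fun X X' g z => ?_⟩
  set P := projectiveResolution X
  set P' := projectiveResolution X'
  let φ : P'.Hom P g := ⟨ProjectiveResolution.lift g P' P, by
    simpa using ProjectiveResolution.lift_commutes_zero g P' P⟩
  obtain ⟨c, rfl⟩ := (ModuleCat.epi_iff_surjective ((P.complex.linearYonedaObj R Y).homologyπ n ≫
    (P.isoExt n Y).inv)).mp inferInstance z
  set m := ((HomologicalComplex.unopFunctor _ _).map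
    ((((linearYoneda R (ModuleCat.{u} R)).obj Y).rightOp.mapHomologicalComplex _).map φ.hom).op)
    with hm
  have h := isoExt_naturality P P' Y n g φ
  have h1 : ((_root_.Ext R (ModuleCat.{u} R) n).map g.op).app Y
      (((P.complex.linearYonedaObj R Y).homologyπ n ≫ (P.isoExt n Y).inv) c) =
      (P'.isoExt n Y).inv ((P'.complex.linearYonedaObj R Y).homologyπ n
        (HomologicalComplex.cyclesMap m n c)) := by
    have h2 := ConcreteCategory.congr_hom h ((P.isoExt n Y).inv
      ((P.complex.linearYonedaObj R Y).homologyπ n c))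
    have h3 := ConcreteCategory.congr_hom (HomologicalComplex.homologyπ_naturality m n) c
    have h4 := ConcreteCategory.congr_hom (P.isoExt n Y).inv_hom_id
      ((P.complex.linearYonedaObj R Y).homologyπ n c)
    refine (P'.isoExt (R := R) n Y).toLinearEquiv.injective ?_
    refine h2.trans ?_
    refine (congrArg (HomologicalComplex.homologyMap m n) h4).trans ?_
    refine h3.trans ?_
    exact (ConcreteCategory.congr_hom (P'.isoExt n Y).inv_hom_id _).symm
  rw [h1]
  erw [he, he, ProjectiveResolution.mk₀_comp_extMk _ _ _ _ φ]
  congr 1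
  exact ConcreteCategory.congr_hom (HomologicalComplex.cyclesMap_i m n) c

end

section
open CategoryTheory Abelian Opposite Limits RingTheory.Sequence

variable {R : Type} [CommRing R]

theorem mem_associatedPrimes_iff_of_isColimit [IsNoetherianRing R] {D : Type} [SmallCategory D]
    [IsFiltered D] (F : D ⥤ ModuleCat.{0} R) (c : Cocone F) (hc : IsColimit c)
    (hF : ∀ {i j : D} (f : i ⟶ j), Function.Injective (F.map f)) (I : Ideal R) :
    I ∈ associatedPrimes R c.pt ↔ ∃ i, I ∈ associatedPrimes R (F.obj i) := by
  have : PreservesColimitsOfShape D (forget (ModuleCat.{0} R)) := inferInstance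
  have hinj : ∀ i, Function.Injective (c.ι.app i) := by
    intro i x y hxy
    obtain ⟨j, f, g, hfg⟩ := Concrete.isColimit_exists_of_rep_eq F hc x y hxy
    refine hF (f ≫ IsFiltered.coeqHom f g) ?_
    nth_rw 2 [IsFiltered.coeq_condition]
    rw [F.map_comp, F.map_comp, ConcreteCategory.comp_apply, ConcreteCategory.comp_apply, hfg]
  constructor
  · intro hI
    obtain ⟨hp, x, hx⟩ := isAssociatedPrime_iff.mp hI
    obtain ⟨i, y, rfl⟩ := Concrete.isColimit_exists_rep F hc x
    refine ⟨i, isAssociatedPrime_iff.mpr ⟨hp, y, ?_⟩⟩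
    rw [hx]
    ext r
    rw [Submodule.mem_colon_singleton, Submodule.mem_colon_singleton, Submodule.mem_bot,
      Submodule.mem_bot, ← map_smul, map_eq_zero_iff _ (hinj i)]
  · rintro ⟨i, hi⟩
    exact associatedPrimes.subset_of_injective (f := (c.ι.app i).hom) (hinj i) hi

theorem mem_associatedPrimes_localCohomology_iff [IsNoetherianRing R] (J : Ideal R)
    (M : ModuleCat.{0} R) (q n : ℕ) (hn : q + 1 = n)
    (hJ : ∀ s, ∃ rs : List R, rs.length = n ∧ (∀ r ∈ rs, r ∈ J ^ s) ∧ IsWeaklyRegular M rs)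
    (I : Ideal R) :
    I ∈ associatedPrimes R ((localCohomology J n).obj M) ↔
      ∃ s : ℕ, I ∈ associatedPrimes R (Abelian.Ext (ModuleCat.of R (R ⧸ J ^ s)) M n) := by
  obtain ⟨e, he⟩ := exists_linearEquiv_ext_natural M q n hn
  let D := localCohomology.diagram (localCohomology.idealPowersDiagram J) n
  let ev := (evaluation (ModuleCat.{0} R) (ModuleCat.{0} R)).obj M
  have hc : IsColimit (ev.mapCocone (colimit.cocone D)) :=
    isColimitOfPreserves ev (colimit.isColimit D)
  refine (mem_associatedPrimes_iff_of_isColimit (D ⋙ ev) _ hc ?_ I).trans ?_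
  · intro i j f
    have h : ∀ z, (D ⋙ ev).map f z = ((_root_.Ext R (ModuleCat.{0} R) n).map
      ((localCohomology.ringModIdeals (localCohomology.idealPowersDiagram J)).map
        f.unop).op).app M z := fun z => rfl
    rw [injective_iff_map_eq_zero]
    intro z hz
    rw [h] at hz
    apply (e _).injective
    refine Eq.trans ?_ (map_zero _).symm
    have hz' := (he _ _ _ z).symm.trans ((congrArg (e _) hz).trans (map_zero _))
    have hepi : Epi ((localCohomology.ringModIdeals (localCohomology.idealPowersDiagram J)).map
        f.unop) := by
      rw [ModuleCat.epi_iff_surjective]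
      intro x
      obtain ⟨r, rfl⟩ := Submodule.Quotient.mk_surjective _ x
      exact ⟨Submodule.Quotient.mk r, rfl⟩
    obtain ⟨rs, hl, hrs, hM⟩ := hJ j.unop.unop
    subst hn
    refine ext_eq_zero_of_epi_of_isWeaklyRegular _ rs ?_ hM hl _ hz'
    intro r hr x
    obtain ⟨a, rfl⟩ := Submodule.Quotient.mk_surjective _ x
    exact (Submodule.Quotient.mk_eq_zero (J ^ j.unop.unop)).mpr
      (Ideal.mul_mem_right a _ (hrs r hr))
  · have h : ∀ i : (ℕᵒᵖ)ᵒᵖ, I ∈ associatedPrimes R ((D ⋙ ev).obj i) ↔ 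
      I ∈ associatedPrimes R (Abelian.Ext (ModuleCat.of R (R ⧸ J ^ i.unop.unop)) M n) := by
      intro i
      rw [← LinearEquiv.AssociatedPrimes.eq (e (ModuleCat.of R (R ⧸ J ^ i.unop.unop)))]
      rfl
    constructor
    · rintro ⟨i, hi⟩
      exact ⟨_, (h i).mp hi⟩
    · rintro ⟨s, hs⟩
      exact ⟨op (op s), (h _).mpr hs⟩

end

section
open CategoryTheory Abelian RingTheory.Sequence

theorem mem_associatedPrimes_hom_quotient_iff {R : Type*} [CommRing R] [IsNoetherianRing R]
    {M : Type*} [AddCommGroup M] [Module R M] (I Q : Ideal R) :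
    Q ∈ associatedPrimes R ((R ⧸ I) →ₗ[R] M) ↔ I ≤ Q ∧ Q ∈ associatedPrimes R M := by
  have hann : ∀ ψ : (R ⧸ I) →ₗ[R] M, (⊥ : Submodule R _).colon {ψ} =
      (⊥ : Submodule R M).colon {ψ (Submodule.Quotient.mk 1)} := by
    intro ψ
    ext r
    rw [Submodule.mem_colon_singleton, Submodule.mem_colon_singleton, Submodule.mem_bot,
      Submodule.mem_bot]
    refine ⟨fun h => LinearMap.congr_fun h (Submodule.Quotient.mk 1), fun h => ?_⟩
    ext
    exact h
  simp only [AssociatedPrimes.mem_iff, isAssociatedPrime_iff]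
  constructor
  · rintro ⟨hQ, ψ, hψ⟩
    rw [hann] at hψ
    refine ⟨fun r hr => ?_, hQ, _, hψ⟩
    rw [hψ, Submodule.mem_colon_singleton, Submodule.mem_bot, ← map_smul,
      ← Submodule.Quotient.mk_smul, (Submodule.Quotient.mk_eq_zero I).mpr (by simpa), map_zero]
  · rintro ⟨hI, hQ, w, hw⟩
    refine ⟨hQ, Submodule.liftQ I (LinearMap.toSpanSingleton R M w) fun r hr => ?_, ?_⟩
    · have := hI hr
      rw [hw, Submodule.mem_colon_singleton, Submodule.mem_bot] at this
      simpa using this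
    · rw [hann]
      exact hw.trans (congrArg (fun v => (⊥ : Submodule R M).colon {v}) (one_smul R w).symm)

theorem mem_associatedPrimes_ext_quotient_iff {R : Type u} [CommRing R] [IsNoetherianRing R]
    (I Q : Ideal R) (rs : List R) (hI : ∀ r ∈ rs, r ∈ I) (hR : IsWeaklyRegular R rs) :
    Q ∈ associatedPrimes R (Ext (ModuleCat.of R (R ⧸ I)) (ModuleCat.of R R) rs.length) ↔
      I ≤ Q ∧ Q ∈ associatedPrimes R (R ⧸ Ideal.ofList rs) := by
  have hN : ∀ r ∈ rs, ∀ x : ModuleCat.of R (R ⧸ I), r • x = 0 := by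
    intro r hr x
    obtain ⟨a, rfl⟩ := Submodule.Quotient.mk_surjective _ x
    exact (Submodule.Quotient.mk_eq_zero I).mpr (I.mul_mem_right a (hI r hr))
  obtain ⟨e⟩ := ext_linearEquiv_of_isWeaklyRegular _ rs hN (ModuleCat.of R R) hR
  rw [LinearEquiv.AssociatedPrimes.eq e]
  refine (mem_associatedPrimes_hom_quotient_iff I Q).trans ?_
  have h : (Ideal.ofList rs • ⊤ : Submodule R R) = Ideal.ofList rs := by simp
  conv_rhs => rw [← h]

theorem mem_associatedPrimes_quotient_ofList_iff {R : Type u} [CommRing R] [IsNoetherianRing R]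
    (Q : Ideal R) (rs rs' : List R) (h : ∀ r ∈ rs, r ∈ Q) (hR : IsWeaklyRegular R rs)
    (h' : ∀ r ∈ rs', r ∈ Q) (hR' : IsWeaklyRegular R rs') (hl : rs.length = rs'.length) :
    Q ∈ associatedPrimes R (R ⧸ Ideal.ofList rs) ↔
      Q ∈ associatedPrimes R (R ⧸ Ideal.ofList rs') := by
  have h1 := mem_associatedPrimes_ext_quotient_iff Q Q rs h hR
  have h2 := mem_associatedPrimes_ext_quotient_iff Q Q rs' h' hR'
  rw [hl] at h1
  simpa using h1.symm.trans h2

/-- An associated prime of a complete intersection contains no longer regular sequence. -/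
theorem length_le_of_mem_associatedPrimes {R : Type u} [CommRing R] [IsNoetherianRing R]
    (Q : Ideal R) (rs rs' : List R) (h : ∀ r ∈ rs, r ∈ Q) (hR : IsWeaklyRegular R rs)
    (h' : ∀ r ∈ rs', r ∈ Q) (hR' : IsWeaklyRegular R rs')
    (hQ : Q ∈ associatedPrimes R (R ⧸ Ideal.ofList rs)) : rs'.length ≤ rs.length := by
  by_contra! hl
  have hN : ∀ r ∈ rs', ∀ x : ModuleCat.of R (R ⧸ Q), r • x = 0 := by
    intro r hr x
    obtain ⟨a, rfl⟩ := Submodule.Quotient.mk_surjective _ x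
    exact (Submodule.Quotient.mk_eq_zero Q).mpr (Q.mul_mem_right a (h' r hr))
  have h1 := (mem_associatedPrimes_ext_quotient_iff Q Q rs h hR).mpr ⟨le_rfl, hQ⟩
  have := ext_subsingleton_of_isWeaklyRegular _ rs' hN (ModuleCat.of R R) hR' _ hl
  rw [associatedPrimes.eq_empty_of_subsingleton] at h1
  exact h1

theorem mem_associatedPrimes_localCohomology_iff_of_isWeaklyRegular {R : Type} [CommRing R]
    [IsNoetherianRing R] (J Q : Ideal R) (rs : List R) (hrs : rs ≠ []) (hJ : ∀ r ∈ rs, r ∈ J)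
    (hR : ∀ s, IsWeaklyRegular R (rs.map (· ^ s))) :
    Q ∈ associatedPrimes R ((localCohomology J rs.length).obj (ModuleCat.of R R)) ↔
      J ≤ Q ∧ Q ∈ associatedPrimes R (R ⧸ Ideal.ofList rs) := by
  have hpow : ∀ s, ∀ r ∈ rs.map (· ^ s), r ∈ J ^ s := by
    simp only [List.mem_map]
    rintro s _ ⟨r, hr, rfl⟩
    exact Ideal.pow_mem_pow (hJ r hr) s
  have h1 : rs.map (· ^ 1) = rs := by simp
  rw [mem_associatedPrimes_localCohomology_iff J _ (rs.length - 1) rs.length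
    (Nat.sub_add_cancel (List.length_pos_iff.mpr hrs))
    (fun s => ⟨rs.map (· ^ s), by simp, hpow s, hR s⟩)]
  have key : ∀ s, Q ∈ associatedPrimes R
      (Ext (ModuleCat.of R (R ⧸ J ^ s)) (ModuleCat.of R R) rs.length) ↔
      J ^ s ≤ Q ∧ Q ∈ associatedPrimes R (R ⧸ Ideal.ofList (rs.map (· ^ s))) := fun s => by
    rw [← mem_associatedPrimes_ext_quotient_iff (J ^ s) Q _ (hpow s) (hR s), List.length_map]
  refine (exists_congr key).trans ?_
  constructor
  · rintro ⟨s, hs, hQ⟩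
    have hJQ : J ≤ Q := hQ.1.le_of_pow_le hs
    refine ⟨hJQ, (mem_associatedPrimes_quotient_ofList_iff Q _ rs (fun r hr => hs (hpow s r hr))
      (hR s) (fun r hr => hJQ (hJ r hr)) (h1 ▸ hR 1) (by simp)).mp hQ⟩
  · rintro ⟨hJQ, hQ⟩
    exact ⟨1, by simpa using hJQ, by rwa [h1]⟩

end

theorem delta_mem_beIdeal_top (k : Type) [Field k] (n : ℕ) (i j : Fin n) :
    delta k n i j ∈ beIdeal k n ⊤ := by
  by_cases h : i = j
  · simp [h, delta]
  · exact Ideal.subset_span ⟨i, j, h, rfl⟩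

theorem ker_le_of_forall_monomial_sub_mem {σ τ k : Type*} [Field k]
    (φ : MvPolynomial σ k →ₗ[k] MvPolynomial τ k) (T : (σ →₀ ℕ) → (τ →₀ ℕ))
    (hφ : ∀ α, φ (monomial α 1) = monomial (T α) 1) (I : Ideal (MvPolynomial σ k))
    (hI : ∀ α β, T α = T β → monomial α (1 : k) - monomial β 1 ∈ I)
    (f : MvPolynomial σ k) (hf : φ f = 0) : f ∈ I := by
  let ψ : MvPolynomial τ k →ₗ[k] MvPolynomial σ k ⧸ I :=
    (basisMonomials τ k).constr k fun γ => Ideal.Quotient.mk I (monomial (Function.invFun T γ) 1)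
  have hψ : ψ ∘ₗ φ = (Ideal.Quotient.mkₐ k I).toLinearMap := by
    refine (basisMonomials σ k).ext fun α => ?_
    have h1 : ψ (monomial (T α) 1) =
        Ideal.Quotient.mk I (monomial (Function.invFun T (T α)) 1) := by
      have := (basisMonomials τ k).constr_basis k
        (fun γ => Ideal.Quotient.mk I (monomial (Function.invFun T γ) 1)) (T α)
      rwa [coe_basisMonomials] at this
    rw [coe_basisMonomials, LinearMap.comp_apply, hφ, h1]
    exact Ideal.Quotient.eq.mpr (hI _ _ (Function.invFun_eq ⟨α, rfl⟩))
  have := LinearMap.congr_fun hψ f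
  rw [LinearMap.comp_apply, hf, map_zero] at this
  exact Ideal.Quotient.eq_zero_iff_mem.mp this.symm

theorem monomial_sub_monomial_mem_beIdeal_top (k : Type) [Field k] (n : ℕ)
    (α β : Fin n ⊕ Fin n →₀ ℕ)
    (h : ∀ i, α (Sum.inl i) + α (Sum.inr i) = β (Sum.inl i) + β (Sum.inr i))
    (hs : ∑ i, α (Sum.inl i) = ∑ i, β (Sum.inl i)) :
    monomial α (1 : k) - monomial β 1 ∈ beIdeal k n ⊤ := by
  induction hN : ∑ i, (β (Sum.inl i) - α (Sum.inl i)) using Nat.strong_induction_on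
    generalizing α with
  | _ N ih =>
  by_cases hle : ∀ i, β (Sum.inl i) ≤ α (Sum.inl i)
  · have heq := (Finset.sum_eq_sum_iff_of_le fun i _ => hle i).mp hs.symm
    have : α = β := by
      ext (i | i)
      · exact (heq i (Finset.mem_univ i)).symm
      · have := heq i (Finset.mem_univ i)
        have := h i
        omega
    simp [this]
  push Not at hle
  obtain ⟨i, hi⟩ := hle
  obtain ⟨j, hj⟩ : ∃ j, β (Sum.inl j) < α (Sum.inl j) := by
    by_contra! hcon
    exact (Finset.sum_lt_sum (fun l _ => hcon l) ⟨i, Finset.mem_univ i, hi⟩).ne hs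
  have hij : i ≠ j := by rintro rfl; omega
  have hi' := h i
  obtain ⟨γ, rfl⟩ : ∃ γ, α = Finsupp.single (Sum.inl j) 1 + Finsupp.single (Sum.inr i) 1 + γ := by
    refine ⟨_, (add_tsub_cancel_of_le ?_).symm⟩
    have h1 : 1 ≤ α (Sum.inl j) := by omega
    have h2 : 1 ≤ α (Sum.inr i) := by omega
    rintro (l | l)
    · by_cases hl : j = l
      · subst hl
        simpa using h1
      · simp [hl]
    · by_cases hl : i = l
      · subst hl
        simpa using h2
      · simp [hl]
  have key := ih _ ?_ (Finsupp.single (Sum.inl i) 1 + Finsupp.single (Sum.inr j) 1 + γ)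
    (fun l => ?_) ?_ rfl
  · have hδ := Ideal.mul_mem_right (monomial γ 1) _ (delta_mem_beIdeal_top k n j i)
    convert add_mem hδ key using 1
    simp only [delta, X, monomial_mul, sub_mul, mul_one]
    ring
  · rw [← hN]
    refine Finset.sum_lt_sum (fun l _ => ?_) ⟨i, Finset.mem_univ i, ?_⟩
    · have := h l
      by_cases hl : j = l <;> by_cases hl' : i = l <;> subst_vars <;>
        simp_all [Finsupp.single_apply] <;> omega
    · simp_all [Finsupp.single_apply]
      omega
  · have := h l
    by_cases hl : j = l <;> by_cases hl' : i = l <;> subst_vars <;>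
      simp_all [Finsupp.single_apply] <;> omega
  · rw [← hs]
    simp [Finsupp.single_apply, Finset.sum_add_distrib]

/-- The ideal of `2`-minors of a generic `2 × n` matrix is the kernel of `x_i ↦ z_i t`,
`y_i ↦ z_i`. -/
theorem beIdeal_top_eq_ker (k : Type) [Field k] (n : ℕ) :
    beIdeal k n ⊤ = RingHom.ker (aeval (Sum.elim (fun i => X (some i) * X none)
      (fun i => X (some i))) : MvPolynomial (Fin n ⊕ Fin n) k →ₐ[k]
        MvPolynomial (Option (Fin n)) k) := by
  apply le_antisymm
  · rw [beIdeal, Ideal.span_le]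
    rintro _ ⟨i, j, -, rfl⟩
    simp only [delta, SetLike.mem_coe, RingHom.mem_ker, map_sub, map_mul, aeval_X, Sum.elim_inl,
      Sum.elim_inr]
    ring
  · intro f hf
    rw [RingHom.mem_ker, ← AlgHom.toLinearMap_apply] at hf
    refine ker_le_of_forall_monomial_sub_mem _
      (fun α => Finsupp.linearCombination ℕ (Sum.elim
        (fun i => Finsupp.single (some i) 1 + Finsupp.single none 1)
        (fun i => Finsupp.single (some i) 1)) α) (fun α => ?_) _ (fun α β h => ?_) f hf
    · rw [AlgHom.toLinearMap_apply, aeval_monomial, map_one, one_mul,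
        Finsupp.linearCombination_apply, Finsupp.prod, Finsupp.sum, monomial_sum_one]
      refine Finset.prod_congr rfl fun a _ => ?_
      rcases a with i | i <;> simp [X, monomial_mul, monomial_pow]
    · have hsum (γ : Fin n ⊕ Fin n →₀ ℕ) := Finsupp.sum_fintype γ (fun a b => b • Sum.elim
        (fun i => Finsupp.single (some i) 1 + Finsupp.single none 1)
        (fun i => Finsupp.single (some i) 1) a) (fun _ => zero_smul _ _)
      simp only [Finsupp.linearCombination_apply, hsum, Fintype.sum_sum_type, Sum.elim_inl,
        Sum.elim_inr] at h
      refine monomial_sub_monomial_mem_beIdeal_top k n α β (fun i => ?_) ?_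
      · simpa [Finsupp.finsetSum_apply, Finsupp.single_apply] using DFunLike.congr_fun h (some i)
      · simpa [Finsupp.finsetSum_apply, Finsupp.single_apply] using DFunLike.congr_fun h none

theorem isPrime_beIdeal_top (k : Type) [Field k] (n : ℕ) : (beIdeal k n ⊤).IsPrime := by
  rw [beIdeal_top_eq_ker]
  exact RingHom.ker_isPrime _

theorem X_inl_notMem_beIdeal_top (k : Type) [Field k] (n : ℕ) (i : Fin n) :
    X (Sum.inl i) ∉ beIdeal k n ⊤ := by
  rw [beIdeal_top_eq_ker, RingHom.mem_ker]
  simp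

theorem exists_monomialOrder_degree_delta (k : Type) [Field k] (n : ℕ) (e : Fin n ≃ Fin n) :
    ∃ m : MonomialOrder.{0, 0} (Fin n ⊕ Fin n), ∀ i j, i < j → m.degree (delta k n (e i) (e j)) =
      Finsupp.single (Sum.inl (e i)) 1 + Finsupp.single (Sum.inr (e j)) 1 := by
  let r : Fin n ⊕ Fin n → ℕ := Sum.elim (fun b => (e.symm b : ℕ)) (fun b => n + b)
  have hr : Function.Injective r := by
    rintro (a | a) (b | b) h <;> simp only [r, Sum.elim_inl, Sum.elim_inr] at h
    · rw [e.symm.injective (Fin.ext h)]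
    · omega
    · omega
    · rw [Fin.ext (Nat.add_left_cancel h)]
  let L := LinearOrder.lift' r hr
  have : @WellFoundedGT (Fin n ⊕ Fin n) L.toLT := @Finite.to_wellFoundedGT _ _ L.toPreorder
  refine ⟨MonomialOrder.lex, fun i j hij => ?_⟩
  have hlt : MonomialOrder.lex.toSyn
      (MonomialOrder.lex.degree (X (Sum.inl (e j)) * X (Sum.inr (e i)) :
        MvPolynomial (Fin n ⊕ Fin n) k)) < MonomialOrder.lex.toSyn
      (MonomialOrder.lex.degree (X (Sum.inl (e i)) * X (Sum.inr (e j)) :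
        MvPolynomial (Fin n ⊕ Fin n) k)) := by
    rw [MonomialOrder.degree_mul (X_ne_zero _) (X_ne_zero _),
      MonomialOrder.degree_mul (X_ne_zero _) (X_ne_zero _)]
    simp only [MonomialOrder.degree_X, MonomialOrder.lex_lt_iff, Finsupp.Lex.lt_iff]
    refine ⟨Sum.inl (e i), fun b hb => ?_, ?_⟩
    · have hb : r b < r (Sum.inl (e i)) := hb
      rcases b with b | b <;> simp only [r, Sum.elim_inl, Sum.elim_inr, e.symm_apply_apply] at hb
      · have h1 : e i ≠ b := by rintro rfl; simp at hb
        have h2 : e j ≠ b := by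
          rintro rfl
          rw [e.symm_apply_apply] at hb
          omega
        simp [h1, h2]
      · omega
    · simp [hij.ne']
  rw [delta, MonomialOrder.degree_sub_of_lt hlt,
    MonomialOrder.degree_mul (X_ne_zero _) (X_ne_zero _)]
  simp only [MonomialOrder.degree_X]

theorem disjoint_support_single_add_single {σ : Type*} {a b : σ} {c : σ →₀ ℕ} (ha : c a = 0)
    (hb : c b = 0) :
    Disjoint (Finsupp.single a 1 + Finsupp.single b 1 : σ →₀ ℕ).support c.support := by
  classical
  rw [Finset.disjoint_left]
  intro x hx hc
  rw [Finsupp.mem_support_iff] at hc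
  rcases Finset.mem_union.mp (Finsupp.support_add hx) with h | h <;>
    rw [Finset.mem_singleton.mp (Finsupp.support_single_subset h)] at hc <;> contradiction

theorem pairwise_disjoint_degree_delta {k : Type} [Field k] {n : ℕ} {e : Fin n ≃ Fin n}
    {m : MonomialOrder (Fin n ⊕ Fin n)}
    (hm : ∀ i j, i < j → m.degree (delta k n (e i) (e j)) =
      Finsupp.single (Sum.inl (e i)) 1 + Finsupp.single (Sum.inr (e j)) 1)
    {l : ℕ} (u v : Fin l → Fin n) (huv : ∀ t, u t < v t) (hu : StrictMono u) (hv : StrictMono v) :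
    (List.ofFn fun t => delta k n (e (u t)) (e (v t))).Pairwise
      fun f g => Disjoint (m.degree f).support (m.degree g).support := by
  rw [List.pairwise_ofFn]
  intro s t hst
  rw [hm _ _ (huv s), hm _ _ (huv t)]
  apply disjoint_support_single_add_single
  · simp [(hu hst).ne']
  · simp [(hv hst).ne']

theorem delta_ne_zero {k : Type} [Field k] {n : ℕ} {i j : Fin n} (h : i ≠ j) :
    delta k n i j ≠ 0 := by
  intro h0
  have := congrArg (eval (Sum.elim (Pi.single i 1) (Pi.single j 1))) h0
  simp [delta, h] at this

theorem ofList_path (k : Type) [Field k] (N : ℕ) :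
    Ideal.ofList (List.ofFn fun t : Fin N => delta k (N + 1) t.castSucc t.succ) =
      pathIdeal k (N + 1) := by
  refine congrArg Ideal.span (Set.ext fun f => ?_)
  simp only [Set.mem_ofPred_eq, List.mem_ofFn]
  constructor
  · rintro ⟨t, rfl⟩
    exact ⟨t.castSucc, by simp, rfl⟩
  · rintro ⟨t, ht, rfl⟩
    exact ⟨⟨t, by omega⟩, rfl⟩

theorem isWeaklyRegular_path_pow (k : Type) [Field k] (N s : ℕ) :
    RingTheory.Sequence.IsWeaklyRegular (MvPolynomial (Fin (N + 1) ⊕ Fin (N + 1)) k)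
      ((List.ofFn fun t : Fin N => delta k (N + 1) t.castSucc t.succ).map (· ^ s)) := by
  obtain ⟨m, hm⟩ := exists_monomialOrder_degree_delta k (N + 1) (Equiv.refl _)
  refine isWeaklyRegular_of_disjoint_degree m _ ?_ ?_
  · simp only [List.mem_map, List.mem_ofFn]
    rintro _ ⟨_, ⟨t, rfl⟩, rfl⟩
    exact pow_ne_zero _ (delta_ne_zero t.castSucc_lt_succ.ne)
  · rw [List.pairwise_map]
    refine (pairwise_disjoint_degree_delta hm Fin.castSucc Fin.succ (fun t => t.castSucc_lt_succ)
      (Fin.strictMono_castSucc) (Fin.strictMono_succ)).imp fun h => ?_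
    rw [m.degree_pow, m.degree_pow]
    exact h.mono Finsupp.support_smul Finsupp.support_smul

theorem isWeaklyRegular_X_cons_delta (k : Type) [Field k] (M : ℕ) (e : Fin (M + 2) ≃ Fin (M + 2)) :
    RingTheory.Sequence.IsWeaklyRegular (MvPolynomial (Fin (M + 2) ⊕ Fin (M + 2)) k)
      (X (Sum.inl (e 0)) :: X (Sum.inr (e 0)) ::
        List.ofFn fun t : Fin M => delta k (M + 2) (e t.succ.castSucc) (e t.succ.succ)) := by
  obtain ⟨m, hm⟩ := exists_monomialOrder_degree_delta k (M + 2) e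
  have hlt (t : Fin M) : t.succ.castSucc < t.succ.succ := t.succ.castSucc_lt_succ
  refine isWeaklyRegular_of_disjoint_degree m _ ?_ ?_
  · simp only [List.mem_cons, List.mem_ofFn]
    rintro _ (rfl | rfl | ⟨t, rfl⟩)
    · exact X_ne_zero _
    · exact X_ne_zero _
    · exact delta_ne_zero (e.injective.ne (hlt t).ne)
  · refine .cons ?_ (.cons ?_ (pairwise_disjoint_degree_delta hm (fun t => t.succ.castSucc)
      (fun t => t.succ.succ) hlt ?_ ?_))
    · simp only [List.mem_cons, List.mem_ofFn]
      rintro _ (rfl | ⟨t, rfl⟩)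
      · simp [MonomialOrder.degree_X]
      · rw [hm _ _ (hlt t)]
        exact (disjoint_support_single_add_single (by simp [MonomialOrder.degree_X])
          (by simp [MonomialOrder.degree_X])).symm
    · simp only [List.mem_ofFn]
      rintro _ ⟨t, rfl⟩
      rw [hm _ _ (hlt t)]
      exact (disjoint_support_single_add_single (by simp [MonomialOrder.degree_X])
        (by simp [MonomialOrder.degree_X])).symm
    · exact (Fin.strictMono_castSucc).comp (Fin.strictMono_succ)
    · exact (Fin.strictMono_succ).comp (Fin.strictMono_succ)

/-- Away from primes containing a column of the matrix, the path ideal and the ideal of all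
`2`-minors agree. -/
theorem exists_notMem_mul_mem_pathIdeal {k : Type} [Field k] {n : ℕ}
    {Q : Ideal (MvPolynomial (Fin n ⊕ Fin n) k)} (hQ : Q.IsPrime)
    (hX : ∀ i : Fin n, X (Sum.inl i) ∉ Q ∨ X (Sum.inr i) ∉ Q)
    {f : MvPolynomial (Fin n ⊕ Fin n) k} (hf : f ∈ beIdeal k n ⊤) :
    ∃ s ∉ Q, s * f ∈ pathIdeal k n := by
  have h1 : (1 : MvPolynomial (Fin n ⊕ Fin n) k) ∉ Q := hQ.one_notMem
  have key (b : ℕ) (hb : b < n) (i : Fin n) (hi : (i : ℕ) ≤ b) :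
      ∃ s ∉ Q, s * delta k n i ⟨b, hb⟩ ∈ pathIdeal k n := by
    induction b with
    | zero =>
      obtain rfl : i = ⟨0, hb⟩ := Fin.ext (Nat.le_zero.mp hi)
      exact ⟨1, h1, by simp [delta]⟩
    | succ b ih =>
      rcases hi.eq_or_lt with hi | hi
      · obtain rfl : i = ⟨b + 1, hb⟩ := Fin.ext hi
        exact ⟨1, h1, by simp [delta]⟩
      obtain ⟨s, hs, hsm⟩ := ih (by omega) (by omega)
      have hδ : delta k n ⟨b, by omega⟩ ⟨b + 1, hb⟩ ∈ pathIdeal k n :=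
        Ideal.subset_span ⟨_, hb, rfl⟩
      rcases hX ⟨b, by omega⟩ with hu | hu
      · refine ⟨s * _, hQ.mul_notMem hs hu, ?_⟩
        convert add_mem (Ideal.mul_mem_left _ (X (Sum.inl ⟨b + 1, hb⟩)) hsm)
          (Ideal.mul_mem_left _ (s * X (Sum.inl i)) hδ) using 1
        simp only [delta]
        ring
      · refine ⟨s * _, hQ.mul_notMem hs hu, ?_⟩
        convert add_mem (Ideal.mul_mem_left _ (X (Sum.inr ⟨b + 1, hb⟩)) hsm)
          (Ideal.mul_mem_left _ (s * X (Sum.inr i)) hδ) using 1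
        simp only [delta]
        ring
  rw [beIdeal] at hf
  induction hf using Submodule.span_induction with
  | mem f hf =>
    obtain ⟨i, j, -, rfl⟩ := hf
    rcases le_total i j with hij | hij
    · exact key j j.2 i hij
    · obtain ⟨s, hs, hsm⟩ := key i i.2 j hij
      refine ⟨s, hs, ?_⟩
      convert neg_mem hsm using 1
      simp only [delta]
      ring
  | zero => exact ⟨1, h1, by simp⟩
  | add f g _ _ ihf ihg =>
    obtain ⟨s, hs, hsf⟩ := ihf
    obtain ⟨t, ht, htg⟩ := ihg
    refine ⟨s * t, hQ.mul_notMem hs ht, ?_⟩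
    convert add_mem (Ideal.mul_mem_left _ t hsf) (Ideal.mul_mem_left _ s htg) using 1
    ring
  | smul a f _ ih =>
    obtain ⟨s, hs, hsf⟩ := ih
    refine ⟨s, hs, ?_⟩
    convert Ideal.mul_mem_left _ a hsf using 1
    rw [smul_eq_mul]
    ring

theorem pathIdeal_le_beIdeal_top (k : Type) [Field k] (n : ℕ) :
    pathIdeal k n ≤ beIdeal k n ⊤ := by
  rw [pathIdeal, Ideal.span_le]
  rintro _ ⟨t, ht, rfl⟩
  exact delta_mem_beIdeal_top k n _ _

theorem beIdeal_top_le_of_pathIdeal_le {k : Type} [Field k] {n : ℕ}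
    {Q : Ideal (MvPolynomial (Fin n ⊕ Fin n) k)} (hQ : Q.IsPrime)
    (hX : ∀ i : Fin n, X (Sum.inl i) ∉ Q ∨ X (Sum.inr i) ∉ Q) (hF : pathIdeal k n ≤ Q) :
    beIdeal k n ⊤ ≤ Q := by
  intro f hf
  obtain ⟨s, hs, hsf⟩ := exists_notMem_mul_mem_pathIdeal hQ hX hf
  exact (hQ.mem_or_mem (hF hsf)).resolve_left hs

theorem beIdeal_top_mem_associatedPrimes (k : Type) [Field k] (n : ℕ) :
    beIdeal k n ⊤ ∈ associatedPrimes (MvPolynomial (Fin n ⊕ Fin n) k)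
      (MvPolynomial (Fin n ⊕ Fin n) k ⧸ pathIdeal k n) := by
  apply Module.associatedPrimes.minimalPrimes_annihilator_subset_associatedPrimes
  rw [Ideal.annihilator_quotient]
  refine ⟨⟨isPrime_beIdeal_top k n, pathIdeal_le_beIdeal_top k n⟩, fun Q hQ hle => ?_⟩
  exact beIdeal_top_le_of_pathIdeal_le hQ.1
    (fun i => .inl fun h => X_inl_notMem_beIdeal_top k n i (hle h)) hQ.2

theorem eq_beIdeal_top_of_mem_associatedPrimes {k : Type} [Field k] {n : ℕ}
    {Q : Ideal (MvPolynomial (Fin n ⊕ Fin n) k)}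
    (hX : ∀ i : Fin n, X (Sum.inl i) ∉ Q ∨ X (Sum.inr i) ∉ Q) (hF : pathIdeal k n ≤ Q)
    (hQ : Q ∈ associatedPrimes (MvPolynomial (Fin n ⊕ Fin n) k)
      (MvPolynomial (Fin n ⊕ Fin n) k ⧸ pathIdeal k n)) :
    Q = beIdeal k n ⊤ := by
  obtain ⟨hp, w, hw⟩ := isAssociatedPrime_iff.mp hQ
  obtain ⟨w, rfl⟩ := Ideal.Quotient.mk_surjective w
  have hmem (x) : x ∈ Q ↔ x * w ∈ pathIdeal k n := by
    rw [hw, Submodule.mem_colon_singleton, Submodule.mem_bot, ← Ideal.Quotient.eq_zero_iff_mem]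
    rfl
  refine le_antisymm (fun h hh => ?_) (beIdeal_top_le_of_pathIdeal_le hp hX hF)
  by_contra hP
  have hwP := ((isPrime_beIdeal_top k n).mem_or_mem
    (pathIdeal_le_beIdeal_top k n ((hmem h).mp hh))).resolve_left hP
  obtain ⟨s, hs, hsw⟩ := exists_notMem_mul_mem_pathIdeal hp hX hwP
  exact hs ((hmem s).mpr hsw)

theorem exists_X_notMem_of_mem_associatedPrimes {k : Type} [Field k] {M : ℕ}
    {Q : Ideal (MvPolynomial (Fin (M + 2) ⊕ Fin (M + 2)) k)}
    (hc : ∀ a : Fin (M + 2), delta k (M + 2) a (a + 1) ∈ Q)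
    (hQ : Q ∈ associatedPrimes (MvPolynomial (Fin (M + 2) ⊕ Fin (M + 2)) k)
      (MvPolynomial (Fin (M + 2) ⊕ Fin (M + 2)) k ⧸
        Ideal.ofList (List.ofFn fun t : Fin (M + 1) => delta k (M + 2) t.castSucc t.succ)))
    (i : Fin (M + 2)) : X (Sum.inl i) ∉ Q ∨ X (Sum.inr i) ∉ Q := by
  by_contra! hcon
  have hlen := length_le_of_mem_associatedPrimes Q _ _ ?_ ?_ ?_
    (isWeaklyRegular_X_cons_delta k M (Equiv.addLeft i)) hQ
  · simp at hlen
  · simp only [List.mem_ofFn]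
    rintro _ ⟨t, rfl⟩
    simpa [Fin.coeSucc_eq_succ] using hc t.castSucc
  · simpa only [pow_one, List.map_id'] using isWeaklyRegular_path_pow k (M + 1) 1
  · simp only [List.mem_cons, List.mem_ofFn]
    rintro _ (rfl | rfl | ⟨t, rfl⟩)
    · simpa using hcon.1
    · simpa using hcon.2
    · simpa [← Fin.coeSucc_eq_succ, add_assoc] using hc (i + t.succ.castSucc)

/-- Let `k` have prime characteristic `p > 0`, `n ≥ 3`, and let `G` be a
Hamiltonian graph on `n` vertices (containing the cycle `C_n`), with `g = J(G)`.  Then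
`Ass_R (H^{n−1}_g (R)) = {J(K_n)}`, where `K_n = ⊤` is the complete graph on the `n`
vertices. -/
theorem stmt18 (n : ℕ) (hn : 3 ≤ n) (k : Type) [Field k] (p : ℕ) (hp : p.Prime)
    [CharP k p] (G : SimpleGraph (Fin n))
    (hpath : ∀ (t : Fin n) (h : (t : ℕ) + 1 < n), G.Adj t ⟨(t : ℕ) + 1, h⟩)
    (hcyc : G.Adj ⟨0, by omega⟩ ⟨n - 1, by omega⟩) :
    associatedPrimes (MvPolynomial (Fin n ⊕ Fin n) k)
      ((localCohomology (beIdeal k n G) (n - 1)).obj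
        (ModuleCat.of (MvPolynomial (Fin n ⊕ Fin n) k) (MvPolynomial (Fin n ⊕ Fin n) k))) =
      {beIdeal k n (⊤ : SimpleGraph (Fin n))} := by
  obtain ⟨M, rfl⟩ : ∃ M, n = M + 2 := ⟨n - 2, by omega⟩
  have hc (a : Fin (M + 2)) : delta k (M + 2) a (a + 1) ∈ beIdeal k (M + 2) G := by
    refine Ideal.subset_span ?_
    induction a using Fin.lastCases with
    | last => exact ⟨_, _, by rw [Fin.last_add_one]; exact hcyc.symm, rfl⟩
    | cast t =>
      exact ⟨_, _, by rw [Fin.coeSucc_eq_succ]; exact hpath t.castSucc (by simp; omega), rfl⟩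
  have key (Q) := mem_associatedPrimes_localCohomology_iff_of_isWeaklyRegular
    (beIdeal k (M + 2) G) Q
    (List.ofFn fun t : Fin (M + 1) => delta k (M + 2) t.castSucc t.succ) (by simp)
    (fun r hr => by
      obtain ⟨t, rfl⟩ := (List.mem_ofFn' _ _).mp hr
      simpa [Fin.coeSucc_eq_succ] using hc t.castSucc)
    (isWeaklyRegular_path_pow k (M + 1))
  rw [List.length_ofFn] at key
  ext Q
  rw [Set.mem_singleton_iff]
  refine (key Q).trans ⟨fun ⟨hle, hQ⟩ => ?_, ?_⟩
  · have hX := exists_X_notMem_of_mem_associatedPrimes (fun a => hle (hc a)) hQ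
    rw [ofList_path] at hQ
    refine eq_beIdeal_top_of_mem_associatedPrimes hX (le_trans ?_ hle) hQ
    rw [pathIdeal, Ideal.span_le]
    rintro _ ⟨t, ht, rfl⟩
    exact Ideal.subset_span ⟨_, _, hpath t ht, rfl⟩
  · rintro rfl
    rw [ofList_path]
    refine ⟨?_, beIdeal_top_mem_associatedPrimes k (M + 2)⟩
    exact Ideal.span_mono fun f ⟨i, j, h, hf⟩ => ⟨i, j, h.ne, hf⟩
end
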